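/- Let r > 1 and s = (s_1, …, s_r) ∈ ℤ^r with all s_i < 0, and suppose r − i ≤ L_{−s_i} for every 1 ≤ i ≤ r − 1. Then the t-adic valuation of ζ(s) equals Σ_{i=1}^r v_t(S_{r−i}(s_i)), where v_t denotes the t-adic valuation on A; in particular ζ(s) ≠ 0. -/

import Mathlib

open Polynomial

/-- The power sum `S_d(-k) = ∑_{a monic, deg a = d} a^k`, written as a sum over the
lower-order coefficients of the monic polynomial. -/
noncomputable def powerSum (Fq : Type) [Field Fq] [Fintype Fq] (d k : ℕ) : Polynomial Fq :=
  ∑ c : Fin d → Fq, (X ^ d + ∑ i : Fin d, C (c i) * X ^ (i : ℕ)) ^ k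

/-- `m` sums to `k` with no carrying of digits in base `p`. -/
def NoCarry (p : ℕ) {n : ℕ} (m : Fin n → ℕ) (k : ℕ) : Prop :=
  (∑ i, m i) = k ∧ ∀ j : ℕ, (∑ i, m i / p ^ j % p) = k / p ^ j % p

/-- The set `U_d(k)`. -/
def Uset (p q d k : ℕ) : Set (Fin (d + 1) → ℕ) :=
  {m | NoCarry p m k ∧ ∀ i : Fin (d + 1), 0 < (i : ℕ) → 0 < m i ∧ (q - 1) ∣ m i}

/-- The weight of an element of `U_d(k)`. -/
def wtU {d : ℕ} (m : Fin (d + 1) → ℕ) : ℕ :=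
  ∑ i : Fin (d + 1), (d - (i : ℕ)) * m i

/-- Strict lexicographic order on tuples. -/
def LexLT {n : ℕ} (x y : Fin n → ℕ) : Prop :=
  ∃ i, (∀ j, j < i → x j = y j) ∧ x i < y i

/-- Lexicographic order on tuples. -/
def LexLE {n : ℕ} (x y : Fin n → ℕ) : Prop := x = y ∨ LexLT x y

/-- `L_k := min_{0 ≤ i < f} l(k p^i)/(q-1)` where `l` is the base-`q` digit sum, `q = p^f`. -/
noncomputable def Lval (p f k : ℕ) (hf : 0 < f) : ℚ :=
  (Finset.range f).inf' ⟨0, Finset.mem_range.mpr hf⟩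
    (fun i => ((Nat.digits (p ^ f) (k * p ^ i)).sum : ℚ) / ((p : ℚ) ^ f - 1))

/-- The set `W_d(N)` of compositions. -/
def Wset (p q d N : ℕ) : Set (Fin d → ℕ) :=
  {Y | NoCarry p Y N ∧ ∀ i : Fin d, (i : ℕ) + 1 < d → 0 < Y i ∧ (q - 1) ∣ Y i}

/-- The weight of a composition. -/
def wtW {d : ℕ} (Y : Fin d → ℕ) : ℕ := ∑ i : Fin d, ((i : ℕ) + 1) * Y i

/-- `X` is the modest (lexicographically largest) composition in `W_d(N)`. -/
def Modest (p q : ℕ) {d : ℕ} (N : ℕ) (X : Fin d → ℕ) : Prop :=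
  X ∈ Wset p q d N ∧ ∀ Y ∈ Wset p q d N, LexLE Y X

/-- `X` is an optimal (minimum weight) composition in `W_d(N)`. -/
def Optimal (p q : ℕ) {d : ℕ} (N : ℕ) (X : Fin d → ℕ) : Prop :=
  X ∈ Wset p q d N ∧ ∀ Y ∈ Wset p q d N, wtW X ≤ wtW Y

/-- `Γ(n) : Fin f → ℕ`, summing the base-`p` digits of `n` in each residue class mod `f`. -/
def Gamma (p f n : ℕ) : Fin f → ℕ :=
  fun i => ∑ j ∈ Finset.range (Nat.log p n + 1), if j % f = (i : ℕ) then n / p ^ j % p else 0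

/-- The cyclic matrix `E`, as a map: `(E x)_i = p x_{i+1} - x_i`, indices mod `f`. -/
def Emap (p : ℕ) {R : Type} [Ring R] {f : ℕ} (x : Fin f → R) : Fin f → R :=
  fun i => (p : R) * x ⟨((i : ℕ) + 1) % f, Nat.mod_lt _ i.pos⟩ - x i

/-- `𝔍 = {Γ(n) : n > 0 is q-even}`, where `q = p ^ f`. -/
def Jfrak (p f : ℕ) : Set (Fin f → ℕ) :=
  {w | ∃ n : ℕ, 0 < n ∧ (p ^ f - 1) ∣ n ∧ Gamma p f n = w}

/-- `I_d`. -/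
def Iset (p f d : ℕ) : Set (Fin f → ℕ) :=
  {u | (∃ n : ℕ, 0 < n ∧ Gamma p f n = u) ∧
    ∃ v : Fin (d - 1) → Fin f → ℕ, (∀ j, v j ∈ Jfrak p f) ∧ (∑ j, v j) < u}

/-- `J_d`. -/
def Jset (p f d : ℕ) : Set (Fin f → ℕ) :=
  if d = 0 then ∅ else Jfrak p f ∩ (Iset p f d \ Iset p f (d + 1))

/-- A composition is `τ`-monotonic. -/
def TauMonotonic (p f : ℕ) {d : ℕ} (X : Fin d → ℕ) : Prop :=
  ∀ i j : Fin d, i < j → ∀ m n : ℕ, X i / p ^ m % p ≠ 0 → X j / p ^ n % p ≠ 0 →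
    m % f = n % f → n ≤ m

/-- `W_d^B(N)`: compositions in `W_d(N)` whose `Γ`-matrix is `B`. -/
def WBset (p f d N : ℕ) (B : Fin d → Fin f → ℕ) : Set (Fin d → ℕ) :=
  {Y | Y ∈ Wset p (p ^ f) d N ∧ ∀ j, Gamma p f (Y j) = B j}

/-- The multizeta value `ζ(-k_1, …, -k_r)` as a (finite) sum over strictly
decreasing tuples of degrees. -/
noncomputable def multizeta (Fq : Type) [Field Fq] [Fintype Fq] {r : ℕ} (k : Fin r → ℕ) :
    Polynomial Fq :=
  ∑ᶠ (dt : Fin r → ℕ) (_ : StrictAnti dt), ∏ i, powerSum Fq (dt i) (k i)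


set_option linter.unusedSectionVars false

namespace MZ
open Finset

theorem coins {ι : Type} [DecidableEq ι] (p : ℕ) (hp : 1 < p) (e : ι → ℕ) :
    ∀ (n : ℕ) (A : Finset ι) (t : ℕ), A.card = n → (∀ b ∈ A, p ^ e b ∣ t) →
      t ≤ ∑ x ∈ A, p ^ e x → ∃ S, S ⊆ A ∧ ∑ x ∈ S, p ^ e x = t := by
  intro n
  induction n with
  | zero =>
    intro A t hA _ ht
    rw [card_eq_zero] at hA
    subst hA
    refine ⟨∅, by simp, ?_⟩
    simp at ht ⊢
    omega
  | succ n ih =>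
    intro A t hA hd ht
    have hne : A.Nonempty := by rw [← card_pos]; omega
    obtain ⟨M, hM, hmax⟩ := exists_max_image A e hne
    by_cases hle : p ^ e M ≤ t
    · obtain ⟨S, hS, hsum⟩ := ih (A.erase M) (t - p ^ e M)
        (by rw [card_erase_of_mem hM]; omega)
        (by
          intro b hb
          have hb' := mem_of_mem_erase hb
          exact Nat.dvd_sub (hd b hb') (pow_dvd_pow p (hmax b hb')))
        (by
          have := add_sum_erase A (fun x => p ^ e x) hM
          omega)
      have hMS : M ∉ S := fun h => (mem_erase.mp (hS h)).1 rfl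
      refine ⟨insert M S, ?_, ?_⟩
      · intro x hx
        rcases mem_insert.mp hx with rfl | hx
        · exact hM
        · exact mem_of_mem_erase (hS hx)
      · rw [sum_insert hMS, hsum]; omega
    · have ht0 : t = 0 := by
        rcases Nat.eq_zero_or_pos t with h | h
        · exact h
        · exact absurd (Nat.le_of_dvd h (hd M hM)) hle
      exact ⟨∅, by simp, by simp [ht0]⟩

/-- A finite set of balls with levels, fewer than `p` on each level. -/
structure Ctx (ι : Type) [Fintype ι] [DecidableEq ι] where
  p : ℕ
  f : ℕ
  m : ℕ
  lev : ι → ℕ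
  hp : p.Prime
  hf : 0 < f
  hm : p ^ f = m + 1
  hlev : ∀ L, (univ.filter (fun x => lev x = L)).card < p

variable {ι : Type} [Fintype ι] [DecidableEq ι]

/-- value -/
def Ctx.v (K : Ctx ι) (A : Finset ι) : ℕ := ∑ x ∈ A, K.p ^ K.lev x
/-- weight -/
def Ctx.w (K : Ctx ι) (s : ℕ) (A : Finset ι) : ℕ := ∑ x ∈ A, K.p ^ ((K.lev x + s) % K.f)
/-- box -/
def bx (φ : ι → ℕ) (i : ℕ) : Finset ι := univ.filter (fun x => φ x = i)
/-- weight of a box -/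
def Ctx.W (K : Ctx ι) (s : ℕ) (φ : ι → ℕ) (i : ℕ) : ℕ := K.w s (bx φ i)
/-- cost -/
def Ctx.cost (K : Ctx ι) (φ : ι → ℕ) : ℕ := ∑ x, φ x * K.p ^ K.lev x
/-- move -/
def mv (φ : ι → ℕ) (S : Finset ι) (j : ℕ) : ι → ℕ := fun x => if x ∈ S then j else φ x
/-- type coins -/
def Ctx.ty (K : Ctx ι) (s : ℕ) (A : Finset ι) : Finset ι := A.filter (fun x => (K.lev x + s) % K.f = 0)

@[simp] theorem mem_bx (φ : ι → ℕ) (i : ℕ) (x : ι) : x ∈ bx φ i ↔ φ x = i := by simp [bx]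

namespace Ctx
variable (K : Ctx ι)

theorem one_lt_p : 1 < K.p := K.hp.one_lt
theorem p_pos : 0 < K.p := K.hp.pos
theorem m_pos : 0 < K.m := by
  have := Nat.one_lt_pow K.hf.ne' K.one_lt_p
  have := K.hm
  omega
theorem p_le : K.p ≤ K.m + 1 := by
  rw [← K.hm]; exact Nat.le_self_pow K.hf.ne' _
theorem pf1 : K.p * K.p ^ (K.f - 1) = K.m + 1 := by
  rw [← K.hm, ← pow_succ']; congr 1; have := K.hf; omega
theorem pf1_pos : 0 < K.p ^ (K.f - 1) := pow_pos K.p_pos _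
theorem pf1_le : K.p ^ (K.f - 1) ≤ K.m := by
  have := K.pf1
  have h2 := K.one_lt_p
  have h3 := K.pf1_pos
  nlinarith

theorem w_union {s : ℕ} {A B : Finset ι} (h : Disjoint A B) : K.w s (A ∪ B) = K.w s A + K.w s B :=
  sum_union h
theorem v_union {A B : Finset ι} (h : Disjoint A B) : K.v (A ∪ B) = K.v A + K.v B :=
  sum_union h
theorem w_sdiff {s : ℕ} {A B : Finset ι} (h : A ⊆ B) : K.w s (B \ A) + K.w s A = K.w s B :=
  sum_sdiff h
theorem v_sdiff {A B : Finset ι} (h : A ⊆ B) : K.v (B \ A) + K.v A = K.v B :=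
  sum_sdiff h
theorem w_mono {s : ℕ} {A B : Finset ι} (h : A ⊆ B) : K.w s A ≤ K.w s B :=
  sum_le_sum_of_subset h
theorem v_mono {A B : Finset ι} (h : A ⊆ B) : K.v A ≤ K.v B :=
  sum_le_sum_of_subset h
theorem pow_le_v {A : Finset ι} {x : ι} (h : x ∈ A) : K.p ^ K.lev x ≤ K.v A :=
  single_le_sum (f := fun x => K.p ^ K.lev x) (fun _ _ => Nat.zero_le _) h
theorem w_pos {s : ℕ} {A : Finset ι} : 0 < K.w s A ↔ A.Nonempty := by
  constructor
  · intro h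
    by_contra h2
    rw [not_nonempty_iff_eq_empty] at h2
    simp [w, h2] at h
  · intro h
    exact sum_pos (fun _ _ => pow_pos K.p_pos _) h

theorem coin (s : ℕ) (A : Finset ι) (n : ℕ) (h : K.p ^ (K.f - 1) ∣ n) (h2 : n ≤ K.w s A) :
    ∃ S, S ⊆ A ∧ K.w s S = n := by
  refine coins K.p K.one_lt_p _ _ A n rfl ?_ h2
  intro b _
  refine (pow_dvd_pow _ ?_).trans h
  have := Nat.mod_lt (K.lev b + s) K.hf
  omega

theorem coin_q (s : ℕ) (A : Finset ι) (h2 : K.m + 1 ≤ K.w s A) :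
    ∃ S, S ⊆ A ∧ K.w s S = K.m + 1 :=
  K.coin s A _ ⟨K.p, by rw [← K.pf1, mul_comm]⟩ h2
theorem coin_1 (s : ℕ) (A : Finset ι) (h2 : K.p ^ (K.f - 1) ≤ K.w s A) :
    ∃ S, S ⊆ A ∧ K.w s S = K.p ^ (K.f - 1) :=
  K.coin s A _ dvd_rfl h2

theorem small (T : ℕ) (Z : Finset ι) (h : ∀ x ∈ Z, K.lev x < T) : K.v Z < K.p ^ T := by
  induction T generalizing Z with
  | zero =>
    have : Z = ∅ := by
      by_contra h2
      obtain ⟨x, hx⟩ := nonempty_iff_ne_empty.mpr h2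
      exact absurd (h x hx) (by omega)
    simp [v, this]
  | succ T ih =>
    have h1 := ih (Z.filter (fun x => K.lev x < T)) (by intro x hx; exact (mem_filter.mp hx).2)
    have h2 : K.v (Z.filter (fun x => ¬ K.lev x < T)) ≤ (K.p - 1) * K.p ^ T := by
      have e : ∀ x ∈ Z.filter (fun x => ¬ K.lev x < T), K.lev x = T := by
        intro x hx
        have := mem_filter.mp hx
        have := h x this.1
        omega
      rw [v, sum_congr rfl (fun x hx => by rw [e x hx]), sum_const, smul_eq_mul]
      apply Nat.mul_le_mul_right
      have := K.hlev T
      have h3 : (Z.filter (fun x => ¬ K.lev x < T)).card ≤ (univ.filter (fun x => K.lev x = T)).card := by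
        apply card_le_card
        intro x hx
        simpa using e x hx
      omega
    have h3 : K.v Z = K.v (Z.filter (fun x => K.lev x < T)) + K.v (Z.filter (fun x => ¬ K.lev x < T)) :=
      (sum_filter_add_sum_filter_not _ _ _).symm
    obtain ⟨r, hr⟩ : ∃ r, K.p = r + 1 := ⟨K.p - 1, by have := K.p_pos; omega⟩
    rw [h3]
    rw [hr] at h1 h2 ⊢
    rw [pow_succ]
    simp only [Nat.add_sub_cancel] at h2
    nlinarith

theorem w_period (s : ℕ) (A : Finset ι) : K.w (s + K.f) A = K.w s A := by
  unfold w
  refine sum_congr rfl fun x _ => ?_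
  rw [← add_assoc, Nat.add_mod_right]

theorem relation (s : ℕ) (A : Finset ι) :
    K.p * K.w s A = K.w (s + 1) A + K.m * (K.ty (s + 1) A).card := by
  unfold w ty
  rw [mul_sum, card_filter, mul_sum, ← sum_add_distrib]
  refine sum_congr rfl fun x _ => ?_
  have hlt := Nat.mod_lt (K.lev x + s) K.hf
  have hf := K.hf
  rw [← pow_succ', ← add_assoc, Nat.add_mod_eq_ite] 
  by_cases h : (K.lev x + s) % K.f + 1 = K.f
  · have e : ((K.lev x + s) + 1) % K.f = 0 := by
      rw [Nat.add_mod, ← Nat.mod_add_mod] 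
      simp only [Nat.add_mod_mod, Nat.mod_mod]
      rw [h, Nat.mod_self]
    rw [← Nat.add_mod_eq_ite, e, h, K.hm]
    simp; omega
  · have e : ((K.lev x + s) + 1) % K.f = (K.lev x + s) % K.f + 1 := by
      rw [← Nat.mod_add_mod, Nat.mod_eq_of_lt]
      omega
    rw [← Nat.add_mod_eq_ite, e]
    simp

theorem w_congr (s : ℕ) (A : Finset ι) : K.w s A ≡ K.p ^ s * K.v A [MOD K.m] := by
  unfold w v
  rw [mul_sum]
  have key : K.p ^ K.f ≡ 1 [MOD K.m] := by
    rw [K.hm]; simp [Nat.ModEq]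
  induction A using Finset.induction_on with
  | empty => simp; rfl
  | insert x A hx ih =>
    rw [sum_insert hx, sum_insert hx]
    refine Nat.ModEq.add ?_ ih
    rw [← pow_add, add_comm s]
    conv_rhs => rw [← Nat.div_add_mod (K.lev x + s) K.f, pow_add, pow_mul]
    have := (key.pow ((K.lev x + s) / K.f)).mul_right (K.p ^ ((K.lev x + s) % K.f))
    rw [one_pow, one_mul] at this
    exact this.symm

theorem coprime (s : ℕ) : Nat.Coprime K.m (K.p ^ s) := by
  apply Nat.Coprime.pow_right
  rw [Nat.coprime_comm, Nat.Prime.coprime_iff_not_dvd K.hp]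
  intro h
  have h1 : K.p ∣ K.m + 1 := ⟨_, K.pf1.symm⟩
  have := (Nat.dvd_add_right h).mp h1
  have := Nat.le_of_dvd one_pos this
  have := K.one_lt_p
  omega

theorem dvd_w_iff (s : ℕ) (A : Finset ι) : K.m ∣ K.w s A ↔ K.m ∣ K.v A := by
  rw [(K.w_congr s A).dvd_iff dvd_rfl]
  exact (K.coprime s).dvd_mul_left

theorem modEq_w_iff (s : ℕ) (A B : Finset ι) :
    K.w s A ≡ K.w s B [MOD K.m] ↔ K.v A ≡ K.v B [MOD K.m] := by
  constructor
  · intro h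
    have h2 := ((K.w_congr s A).symm.trans h).trans (K.w_congr s B)
    exact Nat.ModEq.cancel_left_of_coprime (K.coprime s) h2
  · intro h
    exact ((K.w_congr s A).trans (h.mul_left _)).trans (K.w_congr s B).symm

theorem W_mv (s : ℕ) (φ : ι → ℕ) (S : Finset ι) (b j i : ℕ) (h : S ⊆ bx φ b) :
    K.W s (mv φ S j) i + (if i = b then K.w s S else 0) =
      K.W s φ i + (if i = j then K.w s S else 0) := by
  have e : ∀ (ψ : ι → ℕ), K.W s ψ i = ∑ x, if ψ x = i then K.p ^ ((K.lev x + s) % K.f) else 0 := by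
    intro ψ
    rw [W, w, bx, sum_filter]
  have e2 : ∀ c : ℕ, (if i = c then K.w s S else 0) =
      ∑ x, if x ∈ S ∧ i = c then K.p ^ ((K.lev x + s) % K.f) else 0 := by
    intro c
    by_cases hc : i = c
    · simp [hc, w, sum_ite_mem]
    · simp [hc]
  rw [e, e, e2, e2, ← sum_add_distrib, ← sum_add_distrib]
  refine sum_congr rfl fun x _ => ?_
  unfold mv
  by_cases hx : x ∈ S
  · have : φ x = b := by simpa using h hx
    simp only [hx, this, if_true, true_and]
    simp only [eq_comm (a := i)]
    rw [add_comm]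
  · simp [hx]

theorem cost_mv (φ : ι → ℕ) (S : Finset ι) (b j : ℕ) (h : S ⊆ bx φ b) :
    K.cost (mv φ S j) + b * K.v S = K.cost φ + j * K.v S := by
  have e2 : ∀ c : ℕ, c * K.v S = ∑ x, if x ∈ S then c * K.p ^ K.lev x else 0 := by
    intro c
    simp [v, sum_ite_mem, mul_sum]
  unfold cost
  rw [e2, e2, ← sum_add_distrib, ← sum_add_distrib]
  refine sum_congr rfl fun x _ => ?_
  unfold mv
  by_cases hx : x ∈ S
  · have : φ x = b := by simpa using h hx
    simp only [hx, this, if_true]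
    rw [add_comm]
  · simp [hx]

end Ctx
end MZ

set_option linter.unusedSectionVars false
set_option linter.unusedVariables false
namespace MZ
open Finset
variable {ι : Type} [Fintype ι] [DecidableEq ι]
namespace Ctx
variable (K : Ctx ι)

/-- valid configurations -/
def Valid (d : ℕ) (φ : ι → ℕ) : Prop :=
  (∀ x, φ x ≤ d) ∧ ∀ i < d, (bx φ i).Nonempty ∧ K.m ∣ K.v (bx φ i)
/-- optimal configurations -/
def Opt (d : ℕ) (φ : ι → ℕ) : Prop :=
  K.Valid d φ ∧ ∀ ψ, K.Valid d ψ → K.cost φ ≤ K.cost ψ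
/-- good configurations -/
def Good (d : ℕ) (φ : ι → ℕ) : Prop :=
  K.Valid d φ ∧ ((bx φ d).Nonempty → ¬ K.m ∣ K.v (bx φ d))

theorem valid_iff (s d : ℕ) (φ : ι → ℕ) : K.Valid d φ ↔
    (∀ x, φ x ≤ d) ∧ ∀ i < d, 0 < K.W s φ i ∧ K.m ∣ K.W s φ i := by
  unfold Valid W
  simp only [w_pos, dvd_w_iff]

theorem good_iff (s d : ℕ) (φ : ι → ℕ) : K.Good d φ ↔
    (∀ x, φ x ≤ d) ∧ (∀ i < d, 0 < K.W s φ i ∧ K.m ∣ K.W s φ i) ∧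
      (0 < K.W s φ d → ¬ K.m ∣ K.W s φ d) := by
  unfold Good Valid W
  simp only [w_pos, dvd_w_iff, and_assoc]

theorem mv_le {d : ℕ} {φ : ι → ℕ} (h : ∀ x, φ x ≤ d) (S : Finset ι) {j : ℕ} (hj : j ≤ d) :
    ∀ x, mv φ S j x ≤ d := by
  intro x; unfold mv; split_ifs
  · exact hj
  · exact h x

theorem opt_good {d : ℕ} {φ : ι → ℕ} (hd : 1 ≤ d) (h : K.Opt d φ) : K.Good d φ := by
  refine ⟨h.1, fun hne hdv => ?_⟩
  have hv := (K.valid_iff 0 d φ).mp h.1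
  have h1 : K.Valid d (mv φ (bx φ d) 0) := by
    rw [K.valid_iff 0]
    refine ⟨mv_le hv.1 _ (Nat.zero_le _), fun i hi => ?_⟩
    have e := K.W_mv 0 φ (bx φ d) d 0 i (Subset.refl _)
    rw [if_neg (by omega)] at e
    have h2 := hv.2 i hi
    have h3 : K.m ∣ K.w 0 (bx φ d) := (K.dvd_w_iff _ _).mpr hdv
    rw [add_zero] at e
    rw [e]
    refine ⟨by omega, dvd_add h2.2 ?_⟩
    split_ifs
    · exact h3
    · exact dvd_zero _
  have h2 := h.2 _ h1
  have h3 := K.cost_mv φ (bx φ d) d 0 (Subset.refl _)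
  obtain ⟨x, hx⟩ := hne
  have h4 := K.pow_le_v hx
  have h5 : 0 < K.p ^ K.lev x := pow_pos K.p_pos _
  nlinarith

theorem swap (s : ℕ) {φ : ι → ℕ} {Q P : Finset ι} {b b' : ℕ} (hQ : Q ⊆ bx φ b) (hP : P ⊆ bx φ b')
    (hb : b ≠ b') (hw : K.w s Q = K.w s P) :
    ∃ φ' : ι → ℕ, (∀ i, K.W s φ' i = K.W s φ i) ∧
      K.cost φ' + b * K.v Q + b' * K.v P = K.cost φ + b' * K.v Q + b * K.v P ∧
      P ⊆ bx φ' b ∧ (∀ x, φ' x = φ x ∨ (φ' x = b ∧ φ x = b') ∨ (φ' x = b' ∧ φ x = b)) := by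
  have hP1 : P ⊆ bx (mv φ Q b') b' := by
    intro x hx
    have : φ x = b' := by simpa using hP hx
    simp [mv, this]
  refine ⟨mv (mv φ Q b') P b, ?_, ?_, ?_, ?_⟩
  · intro i
    have h1 := K.W_mv s φ Q b b' i hQ
    have h2 := K.W_mv s (mv φ Q b') P b' b i hP1
    rw [hw] at h1
    omega
  · have h1 := K.cost_mv φ Q b b' hQ
    have h2 := K.cost_mv (mv φ Q b') P b' b hP1
    omega
  · intro x hx
    simp [mv, hx]
  · intro x
    unfold mv
    by_cases h1 : x ∈ P
    · have : φ x = b' := by simpa using hP h1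
      simp [h1, this]
    · by_cases h2 : x ∈ Q
      · have : φ x = b := by simpa using hQ h2
        simp [h1, h2, this]
      · simp [h1, h2]

theorem chain (s b' : ℕ) (hb' : 1 ≤ b') (γ : ℕ → ι) (φ : ι → ℕ) (n : ℕ)
    (hγ : ∀ i, b' ≤ i → i < b' + n → φ (γ i) = i ∧ (K.lev (γ i) + s) % K.f = 0) :
    ∃ φ' : ι → ℕ, (∀ i, K.W s φ' i + (if i = b' then 1 else 0) =
        K.W s φ i + (if i = b' + n then 1 else 0)) ∧
      (∀ x, x ∉ (Ico b' (b' + n)).image γ → φ' x = φ x) ∧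
      K.cost φ' = K.cost φ + K.v ((Ico b' (b' + n)).image γ) ∧ 
      (∀ x, φ' x = 0 ↔ φ x = 0) ∧ (∀ x, φ' x ≤ φ x ∨ φ' x ≤ b' + n) := by
  induction n with
  | zero => exact ⟨φ, by simp, by simp, by simp [v], by simp, by simp⟩
  | succ n ih =>
    obtain ⟨φ', h1, h2, h3, h4, h5⟩ := ih (fun i hi hi2 => hγ i hi (by omega))
    have hg := hγ (b' + n) (by omega) (by omega)
    have hnot : γ (b' + n) ∉ (Ico b' (b' + n)).image γ := by
      intro hmem
      obtain ⟨i, hi, he⟩ := mem_image.mp hmem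
      rw [mem_Ico] at hi
      have := (hγ i hi.1 (by omega)).1
      rw [he, hg.1] at this
      omega
    have hsub : ({γ (b' + n)} : Finset ι) ⊆ bx φ' (b' + n) := by
      intro x hx
      rw [mem_singleton] at hx
      subst hx
      rw [mem_bx, h2 _ hnot, hg.1]
    have hw1 : K.w s {γ (b' + n)} = 1 := by simp [w, hg.2]
    have himg : (Ico b' (b' + (n + 1))).image γ = insert (γ (b' + n)) ((Ico b' (b' + n)).image γ) := by
      rw [← image_insert]
      congr 1
      ext a
      simp only [mem_Ico, mem_insert]
      omega
    refine ⟨mv φ' {γ (b' + n)} (b' + n + 1), ?_, ?_, ?_, ?_, ?_⟩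
    · intro i
      have e1 := h1 i
      have e2 := K.W_mv s φ' _ (b' + n) (b' + n + 1) i hsub
      rw [hw1] at e2
      rw [← add_assoc b' n 1]
      omega
    · intro x hx
      rw [himg, mem_insert, not_or] at hx
      rw [← h2 x hx.2]
      simp [mv, hx.1]
    · have e2 := K.cost_mv φ' _ (b' + n) (b' + n + 1) hsub
      rw [himg, v, sum_insert hnot]
      rw [v, sum_singleton] at e2
      rw [h3] at e2
      unfold v at e2
      rw [add_mul (b' + n) 1] at e2
      omega
    · intro x
      unfold mv
      split_ifs with hx
      · rw [mem_singleton] at hx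
        have h0 := hg.1
        rw [← hx] at h0
        constructor
        · intro h; exact h.elim
        · intro h; omega
      · exact h4 x
    · intro x
      unfold mv
      split_ifs with hx
      · right; omega
      · rcases h5 x with h | h
        · exact Or.inl h
        · right; omega

theorem step2 (s : ℕ) {φ : ι → ℕ} {P : Finset ι} {b : ℕ} (hP : P ⊆ bx φ b)
    (hw : K.w s P = K.p ^ (K.f - 1)) (hs : K.m + 1 ≤ K.W s φ b) :
    ∃ P', P ⊆ P' ∧ P' ⊆ bx φ b ∧ K.w s P' = K.m + 1 := by
  have h1 := K.w_sdiff (s := s) hP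
  have h2 := K.pf1
  have h3 := K.pf1_le
  obtain ⟨S, hS, hw2⟩ := K.coin s (bx φ b \ P) (K.m + 1 - K.p ^ (K.f - 1)) 
    (Nat.dvd_sub ⟨K.p, by rw [← K.pf1, mul_comm]⟩ dvd_rfl) (by unfold W at hs; omega)
  have hdis : Disjoint P S := by
    rw [disjoint_left]
    intro x hx hx2
    exact (mem_sdiff.mp (hS hx2)).2 hx
  refine ⟨P ∪ S, subset_union_left, union_subset hP (hS.trans sdiff_subset), ?_⟩
  rw [K.w_union hdis, hw, hw2]
  omega

theorem good_of_eq (s : ℕ) {d : ℕ} {φ φ' : ι → ℕ} (h : K.Good d φ) (hle : ∀ x, φ' x ≤ d)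
    (hW : ∀ i, K.W s φ' i = K.W s φ i) : K.Good d φ' := by
  rw [K.good_iff s] at h ⊢
  refine ⟨hle, ?_, ?_⟩
  · intro i hi; rw [hW]; exact h.2.1 i hi
  · rw [hW]; exact h.2.2

theorem step (s d T : ℕ) {φ : ι → ℕ} (hG : K.Good d φ) {P : Finset ι} {b' : ℕ} (hb1 : 1 ≤ b')
    (hbd : b' ≤ d) (hP : P ⊆ bx φ b') (hw : K.w s P = K.p ^ (K.f - 1))
    {top : ι} (htop : top ∈ P) (hT : T ≤ K.lev top)
    (hslack : ∃ b, 1 ≤ b ∧ b ≤ d ∧ K.m + 1 ≤ K.W s φ b)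
    (H : ∀ i, 1 ≤ i → i < d → K.W s φ i = K.m →
      ∃ γ, φ γ = i ∧ γ ∉ P ∧ (K.lev γ + s) % K.f = 0 ∧ K.lev γ < T) :
    ∃ (φ' : ι → ℕ) (P' : Finset ι) (b'' : ℕ) (Z : Finset ι), K.Good d φ' ∧
      (∀ x, φ' x = 0 ↔ φ x = 0) ∧ P' ⊆ bx φ' b'' ∧ 1 ≤ b'' ∧ b'' ≤ d ∧ K.w s P' = K.m + 1 ∧
      (∃ y ∈ P', T ≤ K.lev y) ∧
      (∀ x ∈ Z, φ x ≠ 0 ∧ K.lev x < T ∧ (K.lev x + s) % K.f = 0) ∧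
      K.cost φ' ≤ K.cost φ + K.v Z := by
  have hG' := (K.good_iff s d φ).mp hG
  by_cases c1 : ∃ b, 1 ≤ b ∧ b < b' ∧ K.m + 1 ≤ K.W s φ b
  · obtain ⟨b, hb, hbb, hsl⟩ := c1
    have := K.pf1_le
    obtain ⟨Q, hQ, hQw⟩ := K.coin_1 s (bx φ b) (by unfold W at hsl; omega)
    by_cases c2 : ∃ y ∈ Q, T ≤ K.lev y
    · obtain ⟨y, hy, hyT⟩ := c2
      obtain ⟨P', h1, h2, h3⟩ := K.step2 s hQ hQw hsl
      refine ⟨φ, P', b, ∅, hG, by simp, h2, hb, by omega, h3, ⟨y, h1 hy, hyT⟩, by simp, by simp [v]⟩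
    · push Not at c2
      obtain ⟨φ', e1, e2, e3, e4⟩ := K.swap s hQ hP (by omega) (hQw.trans hw.symm)
      obtain ⟨P', h1, h2, h3⟩ := K.step2 s e3 hw (by rw [e1]; exact hsl)
      have hle : ∀ x, φ' x ≤ d := by
        intro x
        have := hG'.1 x
        rcases e4 x with h | h | h <;> omega
      refine ⟨φ', P', b, ∅, K.good_of_eq s hG hle e1, ?_, h2, hb, by omega, h3,
        ⟨top, h1 htop, hT⟩, by simp, ?_⟩
      · intro x
        rcases e4 x with h | h | h <;> omega
      · have h5 := K.small T Q c2
        have h6 := K.pow_le_v htop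
        have h7 := Nat.pow_le_pow_right K.p_pos hT
        have h8 : K.v Q ≤ K.v P := by omega
        obtain ⟨n, rfl⟩ : ∃ n, b' = b + n := ⟨b' - b, by omega⟩
        have h9 := Nat.mul_le_mul_left n h8
        rw [add_mul, add_mul] at e2
        omega
  · push Not at c1
    by_cases c2 : K.m + 1 ≤ K.W s φ b'
    · obtain ⟨P', h1, h2, h3⟩ := K.step2 s hP hw c2
      exact ⟨φ, P', b', ∅, hG, by simp, h2, hb1, hbd, h3, ⟨top, h1 htop, hT⟩, by simp, by simp [v]⟩
    · let b := Nat.find hslack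
      obtain ⟨k1, k2, k3⟩ : 1 ≤ b ∧ b ≤ d ∧ K.m + 1 ≤ K.W s φ b := Nat.find_spec hslack
      have hmin : ∀ i, i < b → ¬ (1 ≤ i ∧ i ≤ d ∧ K.m + 1 ≤ K.W s φ i) := 
        fun i hi => Nat.find_min hslack hi
      have hb'b : b' < b := by
        rcases lt_trichotomy b b' with h | h | h
        · have := c1 b k1 h; omega
        · rw [h] at k3; omega
        · exact h
      clear_value b
      have hγ : ∀ i, ∃ γ, b' ≤ i → i < b → φ γ = i ∧ γ ∉ P ∧ (K.lev γ + s) % K.f = 0 ∧ K.lev γ < T := by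
        intro i
        by_cases hi : b' ≤ i ∧ i < b
        · have h1 := hmin i hi.2
          have h2 := hG'.2.1 i (by omega)
          have h3 := Nat.le_of_dvd h2.1 h2.2
          obtain ⟨γ, hγ⟩ := H i (by omega) (by omega) (by omega)
          exact ⟨γ, fun _ _ => hγ⟩
        · exact ⟨top, fun h1 h2 => absurd ⟨h1, h2⟩ hi⟩
      choose γ hγ using hγ
      obtain ⟨n, rfl⟩ : ∃ n, b = b' + n := ⟨b - b', by omega⟩
      obtain ⟨φ₁, a1, a2, a3, a4, a5⟩ := K.chain s b' hb1 γ φ n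
        (fun i h1 h2 => ⟨(hγ i h1 h2).1, (hγ i h1 h2).2.2.1⟩)
      obtain ⟨B, hB, hBw⟩ := K.coin_q s (bx φ (b' + n)) k3
      have hB1 : B ⊆ bx φ₁ (b' + n) := by
        intro x hx
        have hxb : φ x = b' + n := by simpa using hB hx
        rw [mem_bx, a2, hxb]
        intro hmem
        obtain ⟨i, hi, he⟩ := mem_image.mp hmem
        rw [mem_Ico] at hi
        have := (hγ i hi.1 hi.2).1
        rw [he] at this
        omega
      have eW : ∀ i, K.W s (mv φ₁ B b') i + (if i = b' + n then K.m else 0) =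
          K.W s φ i + (if i = b' then K.m else 0) := by
        intro i
        have e1 := a1 i
        have e2 := K.W_mv s φ₁ B (b' + n) b' i hB1
        rw [hBw] at e2
        split_ifs at * <;> omega
      have hP2 : P ⊆ bx (mv φ₁ B b') b' := by
        intro x hx
        have hxb : φ x = b' := by simpa using hP hx
        rw [mem_bx]
        unfold mv
        split_ifs with h
        · rfl
        · rw [a2, hxb]
          intro hmem
          obtain ⟨i, hi, he⟩ := mem_image.mp hmem
          rw [mem_Ico] at hi
          have := (hγ i hi.1 hi.2).2.1
          rw [he] at this
          exact this hx
      have hpos := hG'.2.1 b' (by omega)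
      obtain ⟨P', h1, h2, h3⟩ := K.step2 s hP2 hw (by
        have := eW b'
        rw [if_neg (by omega), if_pos rfl] at this
        omega)
      refine ⟨mv φ₁ B b', P', b', (Ico b' (b' + n)).image γ, ?_, ?_, h2, hb1, hbd, h3,
        ⟨top, h1 htop, hT⟩, ?_, ?_⟩
      · rw [K.good_iff s]
        refine ⟨?_, ?_, ?_⟩
        · apply mv_le _ _ hbd
          intro x
          have := hG'.1 x
          rcases a5 x with h | h <;> omega
        · intro i hi
          have e := eW i
          obtain ⟨g1, g2⟩ := hG'.2.1 i hi
          constructor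
          · by_cases hib : i = b' + n
            · subst hib
              rw [if_pos rfl] at e; omega
            · rw [if_neg hib] at e; omega
          · have d2 : K.m ∣ (if i = b' + n then K.m else 0) := by split_ifs <;> simp
            have d3 : K.m ∣ (if i = b' then K.m else 0) := by split_ifs <;> simp
            rw [Nat.dvd_add_iff_left d2, e]
            exact dvd_add g2 d3
        · intro hpos
          have e := eW d
          rw [if_neg (show ¬ d = b' by omega), add_zero] at e
          have d2 : K.m ∣ (if d = b' + n then K.m else 0) := by split_ifs <;> simp
          rw [Nat.dvd_add_iff_left d2, e]
          exact hG'.2.2 (by omega)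
      · intro x
        rw [← a4 x]
        unfold mv
        split_ifs with h
        · have : φ₁ x = b' + n := by simpa using hB1 h
          omega
        · rfl
      · intro x hx
        obtain ⟨i, hi, he⟩ := mem_image.mp hx
        rw [mem_Ico] at hi
        have := hγ i hi.1 hi.2
        rw [he] at this
        exact ⟨by omega, this.2.2.2, this.2.2.1⟩
      · have e2 := K.cost_mv φ₁ B (b' + n) b' hB1
        rw [add_mul] at e2
        omega

end Ctx
end MZ

set_option linter.unusedSectionVars false
set_option linter.unusedVariables false
namespace MZ
open Finset
variable {ι : Type} [Fintype ι] [DecidableEq ι]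
/-- balls outside box zero -/
def rs (φ : ι → ℕ) : Finset ι := univ.filter (fun x => φ x ≠ 0)
@[simp] theorem mem_rs (φ : ι → ℕ) (x : ι) : x ∈ rs φ ↔ φ x ≠ 0 := by simp [rs]
theorem rs_congr {φ ψ : ι → ℕ} (h : ∀ x, φ x = 0 ↔ ψ x = 0) : rs φ = rs ψ := by
  ext x; simp [h x]
namespace Ctx
variable (K : Ctx ι)

theorem w_rs (s d : ℕ) (φ : ι → ℕ) (h : ∀ x, φ x ≤ d) :
    K.w s (rs φ) = ∑ i ∈ Icc 1 d, K.W s φ i := by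
  unfold W w
  rw [← sum_fiberwise_of_maps_to (s := rs φ) (t := Icc 1 d) (g := φ)]
  · refine sum_congr rfl fun i hi => sum_congr ?_ fun _ _ => rfl
    ext x
    rw [mem_Icc] at hi
    simp only [mem_filter, mem_rs, mem_bx]
    omega
  · intro x hx
    rw [mem_rs] at hx
    rw [mem_Icc]
    have := h x
    omega

theorem slack {s d : ℕ} {φ : ι → ℕ} (hd : 1 ≤ d) (hG : K.Good d φ) (h : d * K.m ≤ K.w s (rs φ)) :
    ∃ b, 1 ≤ b ∧ b ≤ d ∧ K.m + 1 ≤ K.W s φ b := by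
  rw [K.good_iff s] at hG
  by_contra hcon
  push Not at hcon
  rw [K.w_rs s d φ hG.1] at h
  have : ∑ i ∈ Icc 1 d, K.W s φ i < ∑ i ∈ Icc 1 d, K.m := by
    apply sum_lt_sum
    · intro i hi
      rw [mem_Icc] at hi
      have := hcon i hi.1 hi.2
      omega
    · refine ⟨d, by simp [hd], ?_⟩
      have h1 := hcon d hd le_rfl
      by_contra h2
      have h3 : K.W s φ d = K.m := by omega
      have := hG.2.2 (by rw [h3]; exact K.m_pos)
      rw [h3] at this
      exact this dvd_rfl
  simp at this
  omega

theorem ty_congr (s : ℕ) (A : Finset ι) : (K.ty s A).card ≡ K.w s A [MOD K.p] := by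
  unfold ty w
  rw [card_filter]
  induction A using Finset.induction_on with
  | empty => simp; rfl
  | insert x A hx ih =>
    rw [sum_insert hx, sum_insert hx]
    refine Nat.ModEq.add ?_ ih
    split_ifs with h
    · rw [h]; rfl
    · rw [Nat.ModEq, Nat.zero_mod, eq_comm]
      exact Nat.mod_eq_zero_of_dvd (dvd_pow_self _ h)

theorem mem_ty (s : ℕ) (A : Finset ι) (x : ι) : x ∈ K.ty s A ↔ x ∈ A ∧ (K.lev x + s) % K.f = 0 := by
  simp [ty]

theorem imp (s d T : ℕ) {φ φ' : ι → ℕ} (hO : K.Opt d φ) (hV : K.Good d φ') {P : Finset ι} {b : ℕ}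
    (hP : P ⊆ bx φ' b) (hb : 1 ≤ b) (hw : K.w s P = K.m + 1)
    {y z : ι} (hy : y ∈ P) (hyT : T ≤ K.lev y) (hz : z ∈ P) (hzt : (K.lev z + s) % K.f = 0)
    {Z : Finset ι} (hZ : ∀ x ∈ Z, K.lev x < T) (hc : K.cost φ' ≤ K.cost φ + K.v Z) : False := by
  have hV' := (K.valid_iff s d φ').mp hV.1
  have h1 := K.ty_congr s P
  have h2 : 1 < (K.ty s P).card := by
    have hpos : 0 < (K.ty s P).card := card_pos.mpr ⟨z, (K.mem_ty _ _ _).mpr ⟨hz, hzt⟩⟩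
    have hdv : K.p ∣ (K.ty s P).card := by
      rw [h1.dvd_iff dvd_rfl, hw]
      exact ⟨_, K.pf1.symm⟩
    have := Nat.le_of_dvd hpos hdv
    have := K.one_lt_p
    omega
  obtain ⟨o, ho, hne⟩ := exists_mem_ne h2 y
  rw [mem_ty] at ho
  have hS : P.erase o ⊆ bx φ' b := (erase_subset _ _).trans hP
  have hwS : K.w s (P.erase o) = K.m := by
    have := add_sum_erase P (fun x => K.p ^ ((K.lev x + s) % K.f)) ho.1
    unfold w at hw ⊢
    rw [ho.2, pow_zero] at this
    omega
  have eW : ∀ i, _ := fun i => K.W_mv s φ' (P.erase o) b 0 i hS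
  simp only [hwS] at eW
  have hWb : K.m + 1 ≤ K.W s φ' b := by rw [← hw]; exact K.w_mono hP
  have hval : K.Valid d (mv φ' (P.erase o) 0) := by
    rw [K.valid_iff s]
    refine ⟨mv_le hV'.1 _ (Nat.zero_le _), fun i hi => ?_⟩
    have e := eW i
    obtain ⟨g1, g2⟩ := hV'.2 i hi
    constructor
    · by_cases hib : i = b
      · subst hib
        rw [if_pos rfl] at e; omega
      · rw [if_neg hib] at e; omega
    · have d2 : K.m ∣ (if i = b then K.m else 0) := by split_ifs <;> simp
      have d3 : K.m ∣ (if i = 0 then K.m else 0) := by split_ifs <;> simp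
      rw [Nat.dvd_add_iff_left d2, e]
      exact dvd_add g2 d3
  have c1 := hO.2 _ hval
  have c2 := K.cost_mv φ' (P.erase o) b 0 hS
  have c3 := K.small T Z hZ
  have c4 : K.p ^ K.lev y ≤ K.v (P.erase o) := K.pow_le_v (mem_erase.mpr ⟨hne.symm, hy⟩)
  have c5 := Nat.pow_le_pow_right K.p_pos hyT
  have c6 := Nat.le_mul_of_pos_left (K.v (P.erase o)) (show 0 < b by omega)
  omega

theorem w_single (s : ℕ) {x : ι} (h : (K.lev x + (s + 1)) % K.f = 0) :
    K.w s {x} = K.p ^ (K.f - 1) := by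
  have h1 := K.relation s {x}
  have h2 : K.ty (s + 1) {x} = {x} := by
    ext y; rw [mem_ty, mem_singleton]
    constructor
    · exact fun h => h.1
    · rintro rfl; exact ⟨rfl, h⟩
  have h3 : K.w (s + 1) {x} = 1 := by simp [w, h]
  rw [h2, h3, card_singleton, mul_one, add_comm, ← K.pf1] at h1
  exact Nat.eq_of_mul_eq_mul_left K.p_pos h1

theorem hcount (s : ℕ) (hf2 : 2 ≤ K.f) {φ : ι → ℕ} {P : Finset ι} {b : ℕ} (hP : P ⊆ bx φ b)
    (hw : K.w s P = K.p ^ (K.f - 1)) (i : ℕ) (hi : K.W s φ i = K.m) :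
    K.p ≤ (K.ty s (bx φ i \ P)).card + 1 := by
  have h1 := K.ty_congr s (bx φ i \ P)
  have hpd : K.p ∣ K.p ^ (K.f - 1) := dvd_pow_self _ (by omega)
  have hpm : K.p ∣ K.m + 1 := ⟨_, K.pf1.symm⟩
  have h2 : K.p ∣ K.w s (bx φ i \ P) + 1 := by
    unfold W at hi
    by_cases hib : i = b
    · subst hib
      have := K.w_sdiff (s := s) hP
      rw [hi, hw] at this
      rw [Nat.dvd_add_iff_left hpd]
      convert hpm using 1
      omega
    · have : bx φ i \ P = bx φ i := by
        rw [Finset.sdiff_eq_self_iff_disjoint, disjoint_left]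
        intro x hx hx2
        rw [mem_bx] at hx
        have := hP hx2
        rw [mem_bx] at this
        omega
      rw [this, hi]
      exact hpm
  have h3 : K.p ∣ (K.ty s (bx φ i \ P)).card + 1 := by
    rwa [(h1.add_right 1).dvd_iff dvd_rfl]
  exact Nat.le_of_dvd (by omega) h3

/-- the state of the climb -/
def Climb (d T s0 : ℕ) (φ : ι → ℕ) (n : ℕ) : Prop :=
  ∃ (φ' : ι → ℕ) (P : Finset ι) (b : ℕ) (Z : Finset ι), K.Good d φ' ∧
    (∀ x, φ' x = 0 ↔ φ x = 0) ∧ P ⊆ bx φ' b ∧ 1 ≤ b ∧ b ≤ d ∧ K.w (s0 - n) P = K.p ^ (K.f - 1) ∧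
    (∃ y ∈ P, T ≤ K.lev y) ∧ K.cost φ' ≤ K.cost φ + K.v Z ∧
    ∀ x ∈ Z, φ x ≠ 0 ∧ K.lev x < T ∧ ∃ i < n, (K.lev x + (s0 - i)) % K.f = 0

theorem type_ne {a s0 i n : ℕ} (hin : i < n) (hn : n < K.f) (hs : K.f ≤ s0)
    (h1 : (a + (s0 - i)) % K.f = 0) (h2 : (a + (s0 - n)) % K.f = 0) : False := by
  have h3 := Nat.dvd_sub (Nat.dvd_of_mod_eq_zero h1) (Nat.dvd_of_mod_eq_zero h2)
  have h4 : a + (s0 - i) - (a + (s0 - n)) = n - i := by omega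
  rw [h4] at h3
  have := Nat.le_of_dvd (by omega) h3
  omega

theorem climb_step {d T s0 : ℕ} {φ : ι → ℕ} (hd : 1 ≤ d) (hO : K.Opt d φ) {n : ℕ} (hn : n < K.f)
    (hs0 : K.f ≤ s0) (hC : K.Climb d T s0 φ n) (hsl : d * K.m ≤ K.w (s0 - n) (rs φ)) :
    K.Climb d T s0 φ (n + 1) := by
  obtain ⟨s, hs⟩ : ∃ s, s0 - n = s + 1 := ⟨s0 - n - 1, by omega⟩
  have hs' : s0 - (n + 1) = s := by omega
  by_cases c : ∃ x, φ x ≠ 0 ∧ T ≤ K.lev x ∧ (K.lev x + (s0 - n)) % K.f = 0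
  · obtain ⟨x, hx, hxT, hxt⟩ := c
    refine ⟨φ, {x}, φ x, ∅, K.opt_good hd hO, by simp, by simp, by omega, hO.1.1 x, ?_,
      ⟨x, by simp, hxT⟩, by simp [v], by simp⟩
    rw [hs'] 
    apply K.w_single
    rw [← hs]; exact hxt
  · push Not at c
    obtain ⟨φ', P, b, Z, hG, hz, hP, hb1, hbd, hw, ⟨y, hy, hyT⟩, hcost, hZ⟩ := hC
    have hmem : ∀ x j, φ' x = j → 1 ≤ j → φ x ≠ 0 := by
      intro x j h1 h2 h3
      have := (hz x).mpr h3
      omega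
    have hyb : φ' y = b := by simpa using hP hy
    have hf2 : 2 ≤ K.f := by
      by_contra hcon
      have h1 : K.f = 1 := by have := K.hf; omega
      exact c y (hmem y b hyb hb1) hyT (by rw [h1, Nat.mod_one])
    obtain ⟨φ'', P', b', Γ, g1, g2, g3, g4, g5, g6, ⟨y', hy', hyT'⟩, g8, g9⟩ :=
      K.step (s0 - n) d T hG hb1 hbd hP hw hy hyT
        (K.slack hd hG (by rw [rs_congr hz]; exact hsl)) (by
        intro i hi1 hid hWi
        have h1 := K.hcount (s0 - n) hf2 hP hw i hWi
        have h2 : 0 < (K.ty (s0 - n) (bx φ' i \ P)).card := by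
          have := K.one_lt_p; omega
        obtain ⟨γ, hγ⟩ := card_pos.mp h2
        rw [mem_ty, mem_sdiff, mem_bx] at hγ
        refine ⟨γ, hγ.1.1, hγ.1.2, hγ.2, ?_⟩
        by_contra hcon
        exact c γ (hmem γ i hγ.1.1 hi1) (by omega) hγ.2)
    have hdis : Disjoint Z Γ := by
      rw [disjoint_left]
      intro x hx hx2
      obtain ⟨_, _, i, hi, hit⟩ := hZ x hx
      exact K.type_ne hi hn hs0 hit (g8 x hx2).2.2
    have hcost2 : K.cost φ'' ≤ K.cost φ + K.v (Z ∪ Γ) := by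
      rw [K.v_union hdis]; omega
    have hZ2 : ∀ x ∈ Z ∪ Γ, φ x ≠ 0 ∧ K.lev x < T ∧ ∃ i < n + 1, (K.lev x + (s0 - i)) % K.f = 0 := by
      intro x hx
      rcases mem_union.mp hx with hx | hx
      · obtain ⟨a1, a2, i, hi, hit⟩ := hZ x hx
        exact ⟨a1, a2, i, by omega, hit⟩
      · obtain ⟨a1, a2, a3⟩ := g8 x hx
        exact ⟨fun h => a1 ((hz x).mpr h), a2, n, by omega, a3⟩
    refine ⟨φ'', P', b', Z ∪ Γ, g1, fun x => (g2 x).trans (hz x), g3, g4, g5, ?_, ⟨y', hy', hyT'⟩,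
      hcost2, hZ2⟩
    have hempty : K.ty (s0 - n) P' = ∅ := by
      by_contra hne
      obtain ⟨z, hzt⟩ := nonempty_iff_ne_empty.mpr hne
      rw [mem_ty] at hzt
      exact K.imp (s0 - n) d T hO g1 g3 g4 g6 hy' hyT' hzt.1 hzt.2 (fun x hx => (hZ2 x hx).2.1) hcost2
    have hr := K.relation s P'
    rw [← hs, hempty, g6, card_empty, mul_zero, add_zero, ← K.pf1] at hr
    rw [hs']
    exact Nat.eq_of_mul_eq_mul_left K.p_pos hr

theorem climb {d s0 : ℕ} {φ : ι → ℕ} (hd : 1 ≤ d) (hO : K.Opt d φ) {x : ι} (hx : φ x ≠ 0)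
    (hs0 : K.f ≤ s0) (hT : (K.lev x + s0) % K.f = K.f - 1) (n : ℕ) (hn : n ≤ K.f)
    (hsl : ∀ j < n, d * K.m ≤ K.w (s0 - j) (rs φ)) : K.Climb d (K.lev x) s0 φ n := by
  induction n with
  | zero =>
    exact ⟨φ, {x}, φ x, ∅, K.opt_good hd hO, by simp, by simp, by omega, hO.1.1 x, by simp [w, hT],
      ⟨x, by simp, le_rfl⟩, by simp [v], by simp⟩
  | succ n ih =>
    exact K.climb_step hd hO (by omega) hs0 (ih (by omega) (fun j hj => hsl j (by omega)))
      (hsl n (by omega))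

theorem exists_s0 (T : ℕ) : ∃ s0, K.f ≤ s0 ∧ (T + s0) % K.f = K.f - 1 := by
  have hlt := Nat.mod_lt T K.hf
  have hf := K.hf
  refine ⟨(K.f - 1 - T % K.f) + K.f, by omega, ?_⟩
  rw [← add_assoc, Nat.add_mod_right]
  have h := Nat.div_add_mod T K.f
  have e : T + (K.f - 1 - T % K.f) = K.f * (T / K.f) + (K.f - 1) := by omega
  rw [e, Nat.mul_add_mod, Nat.mod_eq_of_lt]
  omega

theorem no_all_slack {d : ℕ} {φ : ι → ℕ} (hd : 1 ≤ d) (hO : K.Opt d φ)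
    (hsl : ∀ s, d * K.m ≤ K.w s (rs φ)) : False := by
  have hm := K.m_pos
  by_cases hf1 : K.f = 1
  · obtain ⟨b, hb1, hbd, hW⟩ := K.slack hd (K.opt_good hd hO) (hsl 0)
    obtain ⟨P, hP, hw⟩ := K.coin_q 0 (bx φ b) hW
    obtain ⟨y, hy⟩ := K.w_pos.mp (by rw [hw]; omega)
    exact K.imp 0 d 0 hO (K.opt_good hd hO) hP hb1 hw hy (Nat.zero_le _) hy 
      (by rw [hf1, Nat.mod_one]) (Z := ∅) (by simp) (by simp [v])
  · have hf2 : 2 ≤ K.f := by have := K.hf; omega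
    have hne : (rs φ).Nonempty := by
      apply (K.w_pos (s := 0)).mp
      have := hsl 0
      have := Nat.mul_pos hd hm
      omega
    obtain ⟨x, hx, hmax⟩ := exists_max_image (rs φ) K.lev hne
    rw [mem_rs] at hx
    obtain ⟨s0, hs0, hT⟩ := K.exists_s0 (K.lev x)
    obtain ⟨φ', P, b, Z, hG, hz, hP, hb1, hbd, hw, ⟨y, hy, hyT⟩, hcost, hZ⟩ :=
      K.climb hd hO hx hs0 hT (K.f - 1) (by omega) (fun j _ => hsl _)
    have hmem : ∀ x j, φ' x = j → 1 ≤ j → φ x ≠ 0 := by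
      intro x j h1 h2 h3
      have := (hz x).mpr h3
      omega
    have hlevmax : ∀ u j, φ' u = j → 1 ≤ j → K.lev u ≤ K.lev x := fun u j h1 h2 =>
      hmax u ((mem_rs _ _).mpr (hmem u j h1 h2))
    have hyb : φ' y = b := by simpa using hP hy
    have hty : (K.lev x + (s0 - (K.f - 1))) % K.f = 0 := by
      have h1 := Nat.div_add_mod (K.lev x + s0) K.f
      rw [hT] at h1
      have h2 : K.lev x + (s0 - (K.f - 1)) = K.f * ((K.lev x + s0) / K.f) := by omega
      rw [h2, Nat.mul_mod_right]
    obtain ⟨φ'', P', b', Γ, g1, g2, g3, g4, g5, g6, ⟨y', hy', hyT'⟩, g8, g9⟩ :=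
      K.step (s0 - (K.f - 1)) d (K.lev x) hG hb1 hbd hP hw hy hyT
        (K.slack hd hG (by rw [rs_congr hz]; exact hsl _)) (by
        intro i hi1 hid hWi
        have h1 := K.hcount _ hf2 hP hw i hWi
        by_contra hcon
        push Not at hcon
        have h2 : insert y (K.ty (s0 - (K.f - 1)) (bx φ' i \ P)) ⊆
            univ.filter (fun u => K.lev u = K.lev x) := by
          intro u hu
          rw [mem_filter]
          refine ⟨mem_univ _, ?_⟩
          rcases mem_insert.mp hu with rfl | hu
          · exact le_antisymm (hlevmax _ _ hyb hb1) hyT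
          · rw [mem_ty, mem_sdiff, mem_bx] at hu
            exact le_antisymm (hlevmax _ _ hu.1.1 hi1) (hcon u hu.1.1 hu.1.2 hu.2)
        have h3 := card_le_card h2
        rw [card_insert_of_notMem (by
          intro h
          rw [mem_ty, mem_sdiff] at h
          exact h.1.2 hy)] at h3
        have := K.hlev (K.lev x)
        omega)
    have hdis : Disjoint Z Γ := by
      rw [disjoint_left]
      intro x hx hx2
      obtain ⟨_, _, i, hi, hit⟩ := hZ x hx
      exact K.type_ne hi (by omega) hs0 hit (g8 x hx2).2.2
    have hyb' : φ'' y' = b' := by simpa using g3 hy'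
    have hy0 : φ y' ≠ 0 := by
      intro h
      have := (g2 y').mpr ((hz y').mpr h)
      omega
    have hylev : K.lev y' = K.lev x := le_antisymm (hmax y' ((mem_rs _ _).mpr hy0)) hyT'
    refine K.imp (s0 - (K.f - 1)) d (K.lev x) hO g1 g3 g4 g6 hy' hyT' hy' (by rw [hylev]; exact hty) 
      (Z := Z ∪ Γ) ?_ (by rw [K.v_union hdis]; omega)
    intro u hu
    rcases mem_union.mp hu with hu | hu
    · exact (hZ u hu).2.1
    · exact (g8 u hu).2.1

theorem w_add_mul (s n : ℕ) (A : Finset ι) : K.w (s + K.f * n) A = K.w s A := by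
  induction n with
  | zero => simp
  | succ n ih => rw [Nat.mul_succ, ← add_assoc, w_period, ih]

theorem exists_k {d s0 : ℕ} {φ : ι → ℕ} (hd : 1 ≤ d) (hO : K.Opt d φ) (hs0 : K.f ≤ s0) :
    ∃ k, k < K.f ∧ K.w (s0 - k) (rs φ) < d * K.m := by
  by_contra hcon
  push Not at hcon
  refine K.no_all_slack hd hO fun s => ?_
  have hlt := Nat.mod_lt s K.hf
  have h1 := Nat.div_add_mod (s0 - s % K.f) K.f
  have h2 := Nat.mod_lt (s0 - s % K.f) K.hf
  have h3 := hcon _ h2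
  have h4 : s0 - (s0 - s % K.f) % K.f = s % K.f + K.f * ((s0 - s % K.f) / K.f) := by omega
  rw [h4, w_add_mul, ← K.w_add_mul _ (s / K.f), Nat.mod_add_div] at h3
  exact h3

theorem valid_of_eq (s : ℕ) {d : ℕ} {φ φ' : ι → ℕ} (h : K.Valid d φ) (hle : ∀ x, φ' x ≤ d)
    (hW : ∀ i, K.W s φ' i = K.W s φ i) : K.Valid d φ' := by
  rw [K.valid_iff s] at h ⊢
  refine ⟨hle, ?_⟩
  intro i hi; rw [hW]; exact h.2 i hi

theorem main {d : ℕ} {φ : ι → ℕ} (hd : 1 ≤ d) (hO : K.Opt d φ) : ∀ (n : ℕ) (M : Finset ι),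
    (M \ rs φ).card = n → K.v M ≡ K.v (rs φ) [MOD K.m] → (∀ s, (d - 1) * K.m ≤ K.w s M) →
    K.v M < K.v (rs φ) → False := by
  intro n
  induction n using Nat.strong_induction_on with
  | _ n ih =>
  intro M hn hmod hw hv
  by_cases c : ∃ x ∈ M \ rs φ, ∃ y ∈ rs φ \ M, K.lev x = K.lev y
  · obtain ⟨x, hx, y, hy, hxy⟩ := c
    have hx' := mem_sdiff.mp hx
    have hy' := mem_sdiff.mp hy
    have hyM : y ∉ M.erase x := fun h => hy'.2 (mem_of_mem_erase h)
    have hsum : ∀ g : ℕ → ℕ, ∑ u ∈ insert y (M.erase x), g (K.lev u) = ∑ u ∈ M, g (K.lev u) := by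
      intro g
      rw [sum_insert hyM, ← hxy]
      exact add_sum_erase M (fun u => g (K.lev u)) hx'.1
    have hvv : K.v (insert y (M.erase x)) = K.v M := hsum (fun e => K.p ^ e)
    have hww : ∀ s, K.w s (insert y (M.erase x)) = K.w s M := fun s =>
      hsum (fun e => K.p ^ ((e + s) % K.f))
    have hset : insert y (M.erase x) \ rs φ = (M \ rs φ).erase x := by
      rw [insert_sdiff_of_mem _ hy'.1, erase_sdiff_comm]
    have hpos := card_pos.mpr ⟨x, hx⟩
    refine ih (n - 1) (by omega) (insert y (M.erase x)) ?_ (by rwa [hvv]) (fun s => by rw [hww]; exact hw s)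
      (by rwa [hvv])
    rw [hset, card_erase_of_mem hx, hn]
  · push Not at c
    have hinter : ∀ g : ι → ℕ, ∑ u ∈ M, g u + ∑ u ∈ rs φ \ M, g u = ∑ u ∈ rs φ, g u + ∑ u ∈ M \ rs φ, g u := by
      intro g
      rw [← sum_union disjoint_sdiff, ← sum_union disjoint_sdiff, union_sdiff_self_eq_union,
        union_sdiff_self_eq_union, union_comm]
    have hvD : K.v (M \ rs φ) < K.v (rs φ \ M) := by
      have := hinter (fun x => K.p ^ K.lev x)
      unfold v at hv ⊢
      omega
    have hne : (rs φ \ M).Nonempty := by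
      by_contra h
      rw [not_nonempty_iff_eq_empty] at h
      rw [h] at hvD
      simp [v] at hvD
    obtain ⟨π, hπ, hmax⟩ := exists_max_image (rs φ \ M) K.lev hne
    have hlt : ∀ x ∈ M \ rs φ, K.lev x < K.lev π := by
      intro x hx
      by_contra hcon
      have h1 := c x hx π hπ
      have h2 : K.v (rs φ \ M) < K.p ^ (K.lev x) := by
        apply K.small
        intro u hu
        have := hmax u hu
        omega
      have := K.pow_le_v hx
      omega
    have hπ0 : φ π ≠ 0 := by simpa using (mem_sdiff.mp hπ).1
    obtain ⟨s0, hs0, hT⟩ := K.exists_s0 (K.lev π)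
    have hk := K.exists_k hd hO hs0
    let k := Nat.find hk
    obtain ⟨hkf, hkw⟩ : k < K.f ∧ K.w (s0 - k) (rs φ) < d * K.m := Nat.find_spec hk
    have hkmin : ∀ j < k, d * K.m ≤ K.w (s0 - j) (rs φ) := by
      intro j hj
      have := Nat.find_min hk hj
      push Not at this
      exact this (by omega)
    clear_value k
    by_cases c2 : ∃ β ∈ M \ rs φ, ∃ i < k, (K.lev β + (s0 - i)) % K.f = 0
    · obtain ⟨β, hβ, i, hik, hβt⟩ := c2
      obtain ⟨φ', P, b, Z, hG, hz, hP, hb1, hbd, hwP, ⟨y, hy, hyT⟩, hcost, hZ⟩ :=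
        K.climb hd hO hπ0 hs0 hT (i + 1) (by omega) (fun j hj => hkmin j (by omega))
      have hβ0 : φ β = 0 := by simpa using (mem_sdiff.mp hβ).2
      have hβ1 : ({β} : Finset ι) ⊆ bx φ' 0 := by
        intro u hu
        rw [mem_singleton] at hu
        subst hu
        rw [mem_bx]
        exact (hz _).mpr hβ0
      obtain ⟨ψ, e1, e2, e3, e4⟩ := K.swap (s0 - (i + 1)) hβ1 hP (by omega) (by
        rw [hwP]; apply K.w_single
        rw [← hβt]; congr 2; omega)
      have hval : K.Valid d ψ := by
        refine K.valid_of_eq _ hG.1 ?_ e1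
        intro u
        have := hG.1.1 u
        rcases e4 u with h | h | h <;> omega
      have h1 := hO.2 _ hval
      have hβZ : Disjoint Z {β} := by
        rw [disjoint_singleton_right]
        intro h
        exact (hZ β h).1 hβ0
      have h2 := K.small (K.lev π) (Z ∪ {β}) (by
        intro u hu
        rcases mem_union.mp hu with hu | hu
        · exact (hZ u hu).2.1
        · rw [mem_singleton] at hu
          rw [hu]; exact hlt β hβ)
      rw [K.v_union hβZ] at h2
      have h3 := K.pow_le_v hy
      have h4 := Nat.pow_le_pow_right K.p_pos hyT
      have h5 := Nat.le_mul_of_pos_left (K.v Z) (show 0 < b by omega)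
      have h6 : b * (K.v Z + K.v {β}) < b * K.v P := Nat.mul_lt_mul_of_pos_left (by omega) (by omega)
      rw [mul_add] at h6
      omega
    · push Not at c2
      have hwk : K.w (s0 - k) (rs φ) ≤ K.w (s0 - k) M := by
        by_contra hcon
        push Not at hcon
        have h1 := (K.modEq_w_iff (s0 - k) _ _).mpr hmod
        have h2 := (Nat.modEq_iff_dvd' hcon.le).mp h1
        have h3 := Nat.le_of_dvd (by omega) h2
        have h4 := hw (s0 - k)
        have h5 : d * K.m = (d - 1) * K.m + K.m := by
          rw [← Nat.succ_mul]; congr 1; omega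
        omega
      have hdown : ∀ j, j ≤ k → K.w (s0 - (k - j)) (rs φ \ M) ≤ K.w (s0 - (k - j)) (M \ rs φ) := by
        intro j
        induction j with
        | zero =>
          intro _
          have := hinter (fun x => K.p ^ ((K.lev x + (s0 - k)) % K.f))
          unfold w at hwk ⊢
          rw [Nat.sub_zero]
          omega
        | succ j ihj =>
          intro hj
          have h1 := ihj (by omega)
          have e : s0 - (k - (j + 1)) = s0 - (k - j) + 1 := by omega
          have r1 := K.relation (s0 - (k - j)) (rs φ \ M)
          have r2 := K.relation (s0 - (k - j)) (M \ rs φ)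
          have hty : K.ty (s0 - (k - j) + 1) (M \ rs φ) = ∅ := by
            by_contra hne
            obtain ⟨z, hzt⟩ := nonempty_iff_ne_empty.mpr hne
            rw [mem_ty] at hzt
            refine c2 z hzt.1 (k - (j + 1)) (by omega) ?_
            rw [e]; exact hzt.2
          rw [hty, card_empty, mul_zero, add_zero] at r2
          rw [e, ← r2]
          have := Nat.mul_le_mul_left K.p h1
          omega
      have h0 := hdown k le_rfl
      rw [Nat.sub_self, Nat.sub_zero] at h0
      have hπw : K.w s0 {π} = K.p ^ (K.f - 1) := by simp [w, hT]
      have h1 : K.w s0 {π} ≤ K.w s0 (rs φ \ M) := K.w_mono (by simpa using hπ)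
      obtain ⟨Q, hQ, hQw⟩ := K.coin_1 s0 (M \ rs φ) (by omega)
      have hQ0 : Q ⊆ bx φ 0 := by
        intro u hu
        have := (mem_sdiff.mp (hQ hu)).2
        simpa using this
      obtain ⟨ψ, e1, e2, e3, e4⟩ := K.swap s0 hQ0 (P := {π}) (b' := φ π) (by simp) (by omega) (by rw [hQw, hπw])
      have hval : K.Valid d ψ := by
        refine K.valid_of_eq _ hO.1 ?_ e1
        intro u
        have := hO.1.1 u
        have := hO.1.1 π
        rcases e4 u with h | h | h <;> omega
      have h1 := hO.2 _ hval
      have h2 := K.small (K.lev π) Q (fun u hu => hlt u (hQ hu))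
      have h3 : K.v {π} = K.p ^ K.lev π := by simp [v]
      have h6 : φ π * K.v Q < φ π * K.v {π} := Nat.mul_lt_mul_of_pos_left (by omega) (by omega)
      omega

end Ctx
end MZ

set_option linter.unusedSectionVars false
set_option linter.unusedVariables false
namespace MZ
open Finset
variable {ι : Type} [Fintype ι] [DecidableEq ι]
namespace Ctx
variable (K : Ctx ι)

theorem cnt (L : ℕ) (A : Finset ι) : (A.filter (fun x => K.lev x = L)).card = K.v A / K.p ^ L % K.p := by
  have h1 : K.v A = K.v (A.filter (fun x => K.lev x < L)) + K.v (A.filter (fun x => ¬ K.lev x < L)) :=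
    (sum_filter_add_sum_filter_not _ _ _).symm
  have h2 := K.small L (A.filter (fun x => K.lev x < L)) (by intro x hx; exact (mem_filter.mp hx).2)
  have h3 : K.v (A.filter (fun x => ¬ K.lev x < L)) = K.p ^ L * ((A.filter (fun x => K.lev x = L)).card +
      K.p * ∑ x ∈ A.filter (fun x => L < K.lev x), K.p ^ (K.lev x - L - 1)) := by
    have e : A.filter (fun x => ¬ K.lev x < L) = A.filter (fun x => K.lev x = L) ∪ A.filter (fun x => L < K.lev x) := by
      ext x; simp only [mem_filter, mem_union, ← and_or_left]
      refine and_congr_right fun _ => ?_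
      omega
    rw [e, K.v_union, mul_add]
    · congr 1
      · rw [v, sum_congr rfl (fun x hx => by rw [(mem_filter.mp hx).2]), sum_const, smul_eq_mul, mul_comm]
      · rw [v, mul_sum, mul_sum]
        refine sum_congr rfl fun x hx => ?_
        rw [← pow_succ', ← pow_add]
        have := (mem_filter.mp hx).2
        congr 1; omega
    · rw [disjoint_left]
      intro x hx hx2
      have := (mem_filter.mp hx).2
      have := (mem_filter.mp hx2).2
      omega
  have hpos : 0 < K.p ^ L := pow_pos K.p_pos _
  have h4 : (A.filter (fun x => K.lev x = L)).card < K.p :=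
    lt_of_le_of_lt (card_le_card (filter_subset_filter _ (subset_univ _))) (K.hlev L)
  rw [h1, h3, Nat.add_mul_div_left _ _ hpos, Nat.div_eq_of_lt h2, zero_add, Nat.add_mul_mod_self_left,
    Nat.mod_eq_of_lt h4]

theorem perm {φ φ' : ι → ℕ} (h : ∀ i, K.v (bx φ i) = K.v (bx φ' i)) :
    ∃ σ : Equiv.Perm ι, (∀ x, K.lev (σ x) = K.lev x) ∧ ∀ x, φ' (σ x) = φ x := by
  have hc : ∀ c : ℕ × ℕ, Nonempty ({x // (K.lev x, φ x) = c} ≃ {x // (K.lev x, φ' x) = c}) := by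
    rintro ⟨L, i⟩
    rw [← Fintype.card_eq, Fintype.card_subtype, Fintype.card_subtype]
    have e : ∀ ψ : ι → ℕ, (univ.filter (fun x => (K.lev x, ψ x) = (L, i))) = 
        (bx ψ i).filter (fun x => K.lev x = L) := by
      intro ψ; ext x; simp [Prod.ext_iff, and_comm]
    rw [e, e, cnt, cnt, h]
  let e := fun c => (hc c).some
  refine ⟨Equiv.ofFiberEquiv (f := fun x => (K.lev x, φ x)) (g := fun x => (K.lev x, φ' x)) e, ?_⟩
  have := fun x => Equiv.ofFiberEquiv_map (f := fun x => (K.lev x, φ x)) (g := fun x => (K.lev x, φ' x)) e x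
  simp only [Prod.mk.injEq] at this
  exact ⟨fun x => (this x).1, fun x => (this x).2⟩

theorem v_comp {σ : Equiv.Perm ι} (hσ : ∀ x, K.lev (σ x) = K.lev x) (φ : ι → ℕ) (i : ℕ) : K.v (bx (fun x => φ (σ x)) i) = K.v (bx φ i) := by
  unfold v bx
  rw [sum_filter, sum_filter]
  conv_rhs => rw [← Equiv.sum_comp σ]
  simp only [hσ]
theorem cost_comp {σ : Equiv.Perm ι} (hσ : ∀ x, K.lev (σ x) = K.lev x) (φ : ι → ℕ) : K.cost (fun x => φ (σ x)) = K.cost φ := by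
  unfold cost
  conv_rhs => rw [← Equiv.sum_comp σ]
  simp only [hσ]
theorem valid_comp {σ : Equiv.Perm ι} (hσ : ∀ x, K.lev (σ x) = K.lev x) (φ : ι → ℕ) {d : ℕ} (h : K.Valid d φ) : K.Valid d (fun x => φ (σ x)) := by
  refine ⟨fun x => h.1 _, fun i hi => ?_⟩
  rw [K.v_comp hσ]
  refine ⟨?_, (h.2 i hi).2⟩
  obtain ⟨x, hx⟩ := (h.2 i hi).1
  exact ⟨σ.symm x, by simpa using hx⟩
theorem opt_comp {σ : Equiv.Perm ι} (hσ : ∀ x, K.lev (σ x) = K.lev x) (φ : ι → ℕ) {d : ℕ} (h : K.Opt d φ) : K.Opt d (fun x => φ (σ x)) :=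
  ⟨K.valid_comp hσ φ h.1, fun ψ hψ => by rw [K.cost_comp hσ]; exact h.2 ψ hψ⟩

/-- restriction to a subset -/
def restrict (R : Finset ι) : Ctx {x // x ∈ R} where
  p := K.p
  f := K.f
  m := K.m
  lev := fun x => K.lev x
  hp := K.hp
  hf := K.hf
  hm := K.hm
  hlev := by
    intro L
    refine lt_of_le_of_lt ?_ (K.hlev L)
    apply card_le_card_of_injOn Subtype.val
    · intro x hx
      simpa using hx
    · exact Subtype.val_injective.injOn

theorem v_restrict (R : Finset ι) (φ : ι → ℕ) (hR : ∀ x, x ∈ R ↔ φ x ≠ 0) (ψ : {x // x ∈ R} → ℕ)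
    (h : ∀ x : {x // x ∈ R}, φ x = ψ x + 1) (i : ℕ) :
    (K.restrict R).v (bx ψ i) = K.v (bx φ (i + 1)) := by
  unfold v bx
  symm
  refine sum_bij' (fun x hx => ⟨x, by rw [hR]; simp at hx; omega⟩) (fun x _ => x.1) ?_ ?_ ?_ ?_ ?_
  · intro x hx
    have hx' : φ x = i + 1 := by simpa using hx
    have := h ⟨x, by rw [hR]; omega⟩
    simp only [mem_filter, mem_univ, true_and]
    simp only at this
    omega
  · intro x hx
    have hx' : ψ x = i := by simpa using hx
    have := h x
    simp only [mem_filter, mem_univ, true_and]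
    omega
  · intro x hx; rfl
  · intro x hx; rfl
  · intro x hx; rfl

theorem cost_restrict (R : Finset ι) (φ : ι → ℕ) (hR : ∀ x, x ∈ R ↔ φ x ≠ 0) (ψ : {x // x ∈ R} → ℕ)
    (h : ∀ x : {x // x ∈ R}, φ x = ψ x + 1) :
    K.cost φ = (K.restrict R).cost ψ + K.v R := by
  have e1 : K.cost φ = ∑ x ∈ R, φ x * K.p ^ K.lev x := by
    unfold cost
    symm
    apply sum_subset (subset_univ _)
    intro x _ hx
    have : φ x = 0 := by
      by_contra hcon
      exact hx ((hR x).mpr hcon)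
    simp [this]
  rw [e1, cost, v, ← sum_coe_sort R, ← sum_coe_sort R, ← sum_add_distrib]
  refine sum_congr rfl fun x _ => ?_
  rw [h x, add_mul, one_mul]
  rfl

theorem valid_restrict (R : Finset ι) (φ : ι → ℕ) (hR : ∀ x, x ∈ R ↔ φ x ≠ 0) (ψ : {x // x ∈ R} → ℕ)
    (h : ∀ x : {x // x ∈ R}, φ x = ψ x + 1) (d : ℕ) :
    K.Valid (d + 1) φ ↔ (K.restrict R).Valid d ψ ∧ (bx φ 0).Nonempty ∧ K.m ∣ K.v (bx φ 0) := by
  have hne : ∀ i, (bx ψ i).Nonempty ↔ (bx φ (i + 1)).Nonempty := by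
    intro i
    rw [← (K.restrict R).w_pos (s := 0), ← K.w_pos (s := 0)]
    constructor
    · intro hh
      obtain ⟨x, hx⟩ := (K.restrict R).w_pos.mp hh
      rw [K.w_pos]
      refine ⟨x.1, ?_⟩
      rw [mem_bx] at hx ⊢
      rw [h, hx]
    · intro hh
      obtain ⟨x, hx⟩ := K.w_pos.mp hh
      rw [mem_bx] at hx
      rw [w_pos]
      refine ⟨⟨x, (hR x).mpr (by omega)⟩, ?_⟩
      have := h ⟨x, (hR x).mpr (by omega)⟩
      rw [mem_bx]
      simp only at this
      omega
  constructor
  · intro hv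
    refine ⟨⟨?_, ?_⟩, hv.2 0 (by omega)⟩
    · intro x
      have := hv.1 x
      have := h x
      omega
    · intro i hi
      rw [hne, K.v_restrict R φ hR ψ h]
      exact hv.2 (i + 1) (by omega)
  · rintro ⟨hv, h0⟩
    refine ⟨?_, ?_⟩
    · intro x
      by_cases hx : x ∈ R
      · have := h ⟨x, hx⟩
        have := hv.1 ⟨x, hx⟩
        simp only at *
        omega
      · have : φ x = 0 := by
          by_contra hcon
          exact hx ((hR x).mpr hcon)
        omega
    · intro i hi
      cases i with
      | zero => exact h0
      | succ i =>
        have := hv.2 i (by omega)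
        rw [hne, K.v_restrict R φ hR ψ h] at this
        exact this

theorem opt_restrict (φ : ι → ℕ) {d : ℕ} (hO : K.Opt (d + 1) φ) (R : Finset ι) (hR : ∀ x, x ∈ R ↔ φ x ≠ 0) :
    (K.restrict R).Opt d (fun x => φ x.1 - 1) := by
  have h : ∀ x : {x // x ∈ R}, φ x = (fun x : {x // x ∈ R} => φ x.1 - 1) x + 1 := by
    intro x
    have := (hR x).mp x.2
    simp only
    omega
  have hv := (K.valid_restrict R φ hR _ h d).mp hO.1
  refine ⟨hv.1, fun ψ hψ => ?_⟩
  let φ2 : ι → ℕ := fun x => if hx : x ∈ R then ψ ⟨x, hx⟩ + 1 else 0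
  have hR2 : ∀ x, x ∈ R ↔ φ2 x ≠ 0 := by
    intro x
    by_cases hx : x ∈ R <;> simp [φ2, hx]
  have h2 : ∀ x : {x // x ∈ R}, φ2 x = ψ x + 1 := by
    intro x
    simp [φ2, x.2]
  have hbx : bx φ2 0 = bx φ 0 := by
    ext x
    rw [mem_bx, mem_bx]
    have h1 := hR x
    have h2 := hR2 x
    tauto
  have hval : K.Valid (d + 1) φ2 := by
    rw [K.valid_restrict R φ2 hR2 ψ h2, hbx]
    exact ⟨hψ, hv.2⟩
  have := hO.2 _ hval
  rw [K.cost_restrict R φ hR _ h, K.cost_restrict R φ2 hR2 ψ h2] at this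
  omega

theorem v_rs_add (φ : ι → ℕ) : K.v (rs φ) + K.v (bx φ 0) = K.v univ := by
  unfold v rs bx
  rw [add_comm]
  exact sum_filter_add_sum_filter_not _ _ _

theorem v_rs_le {d : ℕ} {φ φ' : ι → ℕ} (hd : 1 ≤ d) (h : K.Opt d φ) (h' : K.Opt d φ') :
    K.v (rs φ) ≤ K.v (rs φ') := by
  by_contra hcon
  push Not at hcon
  refine K.main hd h _ (rs φ') rfl ?_ ?_ hcon
  · have h1 := K.v_rs_add φ
    have h2 := K.v_rs_add φ'
    have h3 : K.v (bx φ' 0) ≡ K.v (bx φ 0) [MOD K.m] := by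
      have := (h.1.2 0 hd).2
      have := (h'.1.2 0 hd).2
      rw [Nat.ModEq, Nat.mod_eq_zero_of_dvd this, Nat.mod_eq_zero_of_dvd (h.1.2 0 hd).2]
    refine Nat.ModEq.add_right_cancel h3 ?_
    rw [h1, h2]
  · intro s
    have hv := (K.valid_iff s d φ').mp h'.1
    rw [K.w_rs s d φ' hv.1]
    calc (d - 1) * K.m = ∑ i ∈ Ico 1 d, K.m := by simp
      _ ≤ ∑ i ∈ Ico 1 d, K.W s φ' i := sum_le_sum (fun i hi => by
          have := hv.2 i (mem_Ico.mp hi).2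
          exact Nat.le_of_dvd this.1 this.2)
      _ ≤ _ := sum_le_sum_of_subset Ico_subset_Icc_self
end Ctx

theorem uniq : ∀ (d : ℕ) (ι : Type) [Fintype ι] [DecidableEq ι] (K : Ctx ι) (φ φ' : ι → ℕ),
    K.Opt d φ → K.Opt d φ' → ∀ i, K.v (bx φ i) = K.v (bx φ' i) := by
  intro d
  induction d with
  | zero =>
    intro ι _ _ K φ φ' h h' i
    congr 2
    ext x
    have := h.1.1 x
    have := h'.1.1 x
    omega
  | succ d ih =>
    intro ι _ _ K φ φ' h h' 
    have hR : K.v (rs φ) = K.v (rs φ') := 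
      le_antisymm (K.v_rs_le (by omega) h h') (K.v_rs_le (by omega) h' h)
    have hB : K.v (bx φ 0) = K.v (bx φ' 0) := by
      have := K.v_rs_add φ
      have := K.v_rs_add φ'
      omega
    have key : ∀ ψ : ι → ℕ, ∀ i, K.v (bx (fun x => if ψ x = 0 then 0 else 1) i) = 
        if i = 0 then K.v (bx ψ 0) else if i = 1 then K.v (rs ψ) else 0 := by
      intro ψ i
      by_cases h0 : i = 0
      · rw [if_pos h0]
        congr 1; ext x; simp [h0]
      · rw [if_neg h0]
        by_cases h1 : i = 1
        · rw [if_pos h1]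
          congr 1; ext x; simp [h1]
        · rw [if_neg h1]
          have : bx (fun x => if ψ x = 0 then 0 else 1) i = ∅ := by
            ext x; simp only [mem_bx, notMem_empty, iff_false]
            split_ifs <;> omega
          rw [this]; rfl
    obtain ⟨σ, hσ, hσ2⟩ := K.perm (φ := fun x => if φ x = 0 then 0 else 1)
      (φ' := fun x => if φ' x = 0 then 0 else 1) (by intro i; rw [key, key, hR, hB])
    have h'' := K.opt_comp hσ φ' h'
    have hRR : ∀ x, x ∈ rs φ ↔ φ' (σ x) ≠ 0 := by
      intro x
      have := hσ2 x
      rw [mem_rs]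
      split_ifs at this <;> simp_all
    have r1 := K.opt_restrict φ h (rs φ) (fun x => mem_rs _ _)
    have r2 := K.opt_restrict _ h'' (rs φ) hRR
    have hh := ih _ _ _ _ r1 r2
    intro i
    rw [← K.v_comp hσ φ']
    cases i with
    | zero =>
      rw [K.v_comp hσ, hB]
    | succ i =>
      have e := hh i
      rw [K.v_restrict (rs φ) φ (fun x => mem_rs _ _), K.v_restrict (rs φ) _ hRR] at e
      · exact e
      · intro x
        have := (hRR x).mp x.2
        omega
      · intro x
        have := (mem_rs _ _).mp x.2
        omega

theorem opt_card (K : Ctx ι) (d : ℕ) (φ : ι → ℕ) (hO : K.Opt d φ) (S : Finset (ι → ℕ))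
    (hS : ∀ ψ, ψ ∈ S ↔ K.Opt d ψ) : ¬ K.p ∣ S.card := by
  classical
  let H := MulAction.stabilizer (Equiv.Perm ι)ᵈᵐᵃ (fun x => K.lev x)
  have hH : ∀ g : H, ∀ x, K.lev (DomMulAct.mk.symm g.1 x) = K.lev x := by
    intro g x
    have := g.2
    rw [DomMulAct.mem_stabilizer_iff] at this
    exact congrFun this x
  have horb : (S : Set (ι → ℕ)) = MulAction.orbit H φ := by
    ext ψ
    rw [mem_coe, hS]
    constructor
    · intro h
      obtain ⟨σ, h1, h2⟩ := K.perm (uniq d ι K ψ φ h hO)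
      refine ⟨⟨DomMulAct.mk σ, ?_⟩, ?_⟩
      · rw [DomMulAct.mem_stabilizer_iff]
        funext x
        exact h1 x
      · funext x
        exact h2 x
    · rintro ⟨g, rfl⟩
      exact K.opt_comp (hH g) φ hO
  have h1 : S.card ∣ Nat.card H := by
    have := MulAction.index_stabilizer H φ
    rw [← horb, Set.ncard_coe_finset] at this
    rw [← this]
    exact Subgroup.index_dvd_card _
  intro hdvd
  have h2 := hdvd.trans h1
  have h3 : Nat.card H = Fintype.card {g : Equiv.Perm ι // K.lev ∘ g = K.lev} := by
    rw [← Nat.card_eq_fintype_card]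
    refine Nat.card_congr (Equiv.subtypeEquiv DomMulAct.mk.symm ?_)
    intro g
    exact DomMulAct.mem_stabilizer_iff
  rw [h3, DomMulAct.stabilizer_card'] at h2
  obtain ⟨L, _, hL⟩ := (Prime.dvd_finsetProd_iff K.hp.prime _).mp h2
  rw [K.hp.dvd_factorial, Fintype.card_subtype] at hL
  have := K.hlev L
  omega

end MZ

set_option linter.unusedSectionVars false
set_option linter.unusedVariables false
namespace MZ
open Finset
variable {ι : Type} [Fintype ι] [DecidableEq ι]
namespace Ctx
variable (K : Ctx ι)

theorem w_modf (s : ℕ) (A : Finset ι) : K.w s A = K.w (s % K.f) A := by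
  rw [← K.w_add_mul (s % K.f) (s / K.f), Nat.mod_add_div]

theorem exists_U (n : ℕ → ℕ) (hn : ∀ j, 1 ≤ n j) (hper : ∀ j, n (j + K.f) = n j) :
    ∃ U : ℕ → ℕ, (∀ j, 1 ≤ U j) ∧ (∀ j, U j ≤ n j) ∧ (∀ j, U (j + 1) ≤ K.p * U j) ∧
      (∀ j, U (j + 1) = n (j + 1) ∨ U (j + 1) = K.p * U j) ∧ (∀ j, U (j + K.f) = U j) := by
  let g : ℕ → ℕ → ℕ := fun j i => K.p ^ i * n (j + i * (K.f - 1))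
  have hg : ∀ j i, g (j + 1) (i + 1) = K.p * g j i := by
    intro j i
    have : j + 1 + (i + 1) * (K.f - 1) = j + i * (K.f - 1) + K.f := by
      rw [add_mul]
      have := K.hf
      omega
    simp only [g]
    rw [this, hper, pow_succ]
    ring
  have hmin : ∀ j, ∃ i, ∀ i', g j i ≤ g j i' := fun j => 
    ⟨Function.argmin (g j), fun i' => Function.argmin_le (g j) i'⟩
  choose I hI using hmin
  have hle : ∀ j, g (j + 1) (I (j + 1)) ≤ K.p * g j (I j) := by
    intro j
    rw [← hg]
    exact hI _ _
  refine ⟨fun j => g j (I j), ?_, ?_, hle, ?_, ?_⟩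
  · intro j
    exact Nat.mul_pos (pow_pos K.p_pos _) (hn _)
  · intro j
    have := hI j 0
    simpa [g] using this
  · intro j
    rcases h : I (j + 1) with _ | i
    · left
      simp [g, h]
    · right
      have h1 := hle j
      rw [h, hg] at h1
      simp only [h]
      rw [hg]
      exact le_antisymm h1 (Nat.mul_le_mul_left _ (hI j i))
  · intro j
    have e : ∀ i, g (j + K.f) i = g j i := by
      intro i
      simp only [g]
      rw [add_right_comm, hper]
    apply le_antisymm
    · exact (hI _ _).trans (e _).le
    · exact (hI _ _).trans (e _).ge

theorem exists_B (d : ℕ) (A : Finset ι) (h : ∀ s, (d + 1) * K.m ≤ K.w s A) :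
    ∃ B, B ⊆ A ∧ B.Nonempty ∧ K.m ∣ K.v B ∧ ∀ s, d * K.m ≤ K.w s (A \ B) := by
  have hm := K.m_pos
  have hdiv : ∀ s, d + 1 ≤ K.w s A / K.m := fun s => (Nat.le_div_iff_mul_le hm).mpr (h s)
  obtain ⟨U, hU1, hUn, hUp, hUc, hUper⟩ := K.exists_U (fun j => K.w j A / K.m - d)
    (fun j => by have := hdiv j; omega) (fun j => by simp only [w_period])
  have hcard : ∀ j, K.p * U j - U (j + 1) ≤ (K.ty (j + 1) A).card := by
    intro j
    rcases hUc j with hc | hc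
    · have hr := K.relation j A
      have h1 := Nat.div_add_mod (K.w j A) K.m
      have h2 := Nat.div_add_mod (K.w (j + 1) A) K.m
      have h3 := Nat.mod_lt (K.w (j + 1) A) hm
      have h4 := hdiv j
      have h5 := hdiv (j + 1)
      have h6 := hUn j
      have hp1 := K.one_lt_p
      obtain ⟨a, ha⟩ : ∃ a, K.w j A / K.m = a + d := ⟨_, (Nat.sub_add_cancel (by omega)).symm⟩
      obtain ⟨b, hb⟩ : ∃ b, K.w (j + 1) A / K.m = b + d := ⟨_, (Nat.sub_add_cancel (by omega)).symm⟩
      rw [ha] at h1 h6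
      rw [hb] at h2 hc
      rw [Nat.add_sub_cancel] at hc h6
      rw [hc]
      have key : K.m * (K.p * U j) < K.m * ((K.ty (j + 1) A).card + b + 1) := by
        have e1 : K.m * (K.p * U j) ≤ K.m * (K.p * a) := Nat.mul_le_mul_left _ (Nat.mul_le_mul_left _ h6)
        have e2 : K.p * (K.m * (a + d)) ≤ K.p * K.w j A := Nat.mul_le_mul_left _ (by omega)
        have e3 : K.m * d ≤ K.p * (K.m * d) := Nat.le_mul_of_pos_left _ (by omega)
        rw [hr] at e2
        nlinarith
      have := Nat.lt_of_mul_lt_mul_left key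
      omega
    · omega
  have hch : ∀ j, ∃ t, t ⊆ K.ty (j + 1) A ∧ t.card = K.p * U j - U (j + 1) := fun j =>
    exists_subset_card_eq (hcard j)
  choose t ht htc using hch
  let B := (range K.f).biUnion t
  have hBA : B ⊆ A := by
    intro x hx
    obtain ⟨j, _, hj⟩ := mem_biUnion.mp hx
    exact ((K.mem_ty _ _ _).mp (ht j hj)).1
  have hty : ∀ j < K.f, K.ty (j + 1) B = t j := by
    intro j hj
    ext x
    rw [mem_ty]
    constructor
    · rintro ⟨hx, hxt⟩
      obtain ⟨i, hi, hit⟩ := mem_biUnion.mp hx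
      rw [mem_range] at hi
      have h1 := ((K.mem_ty _ _ _).mp (ht i hit)).2
      have : i = j := by
        have h2 : (K.lev x + (i + 1)) ≡ (K.lev x + (j + 1)) [MOD K.f] := by
          rw [Nat.ModEq, h1, hxt]
        have h3 := Nat.ModEq.add_right_cancel' 1 (Nat.ModEq.add_left_cancel' _ h2)
        rwa [Nat.ModEq, Nat.mod_eq_of_lt hi, Nat.mod_eq_of_lt hj] at h3
      rwa [← this]
    · intro hx
      exact ⟨mem_biUnion.mpr ⟨j, mem_range.mpr hj, hx⟩, ((K.mem_ty _ _ _).mp (ht j hx)).2⟩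
  have hy : ∀ j ≤ K.f, ((K.w j B : ℤ) - K.m * U j) = K.p ^ j * ((K.w 0 B : ℤ) - K.m * U 0) := by
    intro j
    induction j with
    | zero => intro _; simp
    | succ j ih =>
      intro hj
      have h1 := ih (by omega)
      have hr := K.relation j B
      rw [hty j (by omega), htc] at hr
      zify [hUp j] at hr
      rw [pow_succ, mul_right_comm, ← h1]
      linear_combination -hr
  have h0 : ((K.w 0 B : ℤ) - K.m * U 0) = 0 := by
    have h1 := hy K.f le_rfl
    have h2 := K.w_period 0 B
    have h3 := hUper 0
    rw [zero_add] at h2 h3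
    rw [h2, h3] at h1
    have h4 : (K.p : ℤ) ^ K.f = K.m + 1 := by exact_mod_cast K.hm
    rw [h4] at h1
    have h5 : (K.m : ℤ) * ((K.w 0 B : ℤ) - K.m * U 0) = 0 := by linear_combination -h1
    rcases mul_eq_zero.mp h5 with h6 | h6
    · omega
    · exact h6
  have hw : ∀ j ≤ K.f, K.w j B = K.m * U j := by
    intro j hj
    have := hy j hj
    rw [h0, mul_zero, sub_eq_zero] at this
    exact_mod_cast this
  refine ⟨B, hBA, ?_, ?_, ?_⟩
  · apply (K.w_pos (s := 0)).mp
    rw [hw 0 (Nat.zero_le _)]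
    exact Nat.mul_pos hm (hU1 0)
  · rw [← K.dvd_w_iff 0, hw 0 (Nat.zero_le _)]
    exact dvd_mul_right _ _
  · intro s
    rw [K.w_modf]
    have hlt := Nat.mod_lt s K.hf
    have h1 := K.w_sdiff (s := s % K.f) hBA
    rw [hw _ hlt.le] at h1
    have h2 := hUn (s % K.f)
    have h3 := hdiv (s % K.f)
    have h4 : K.m * (U (s % K.f) + d) ≤ K.w (s % K.f) A := by
      refine le_trans (Nat.mul_le_mul_left _ ?_) (Nat.mul_div_le _ K.m)
      omega
    rw [mul_add, mul_comm _ d] at h4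
    omega

theorem exists_valid_aux (d : ℕ) : ∀ (A : Finset ι), (∀ s, d * K.m ≤ K.w s A) →
    ∃ φ : ι → ℕ, K.Valid d φ ∧ ∀ x ∉ A, φ x = d := by
  induction d with
  | zero => intro A _; exact ⟨fun _ => 0, ⟨by simp, by simp⟩, by simp⟩
  | succ d ih =>
    intro A hA
    obtain ⟨B, hB, hne, hdv, hw⟩ := K.exists_B d A hA
    obtain ⟨φ, hv, hφ⟩ := ih (A \ B) hw
    have hφB : ∀ x ∈ B, φ x = d := fun x hx => hφ x (by simp [hx])
    have hb0 : bx (fun x => if x ∈ B then 0 else φ x + 1) 0 = B := by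
      ext x; rw [mem_bx]; split_ifs with h <;> simp [h]
    have hbs : ∀ i < d, bx (fun x => if x ∈ B then 0 else φ x + 1) (i + 1) = bx φ i := by
      intro i hi
      ext x; rw [mem_bx, mem_bx]
      split_ifs with h
      · have := hφB x h
        constructor
        · intro h'
          exact absurd h' (by simp)
        · intro h'
          omega
      · simp
    refine ⟨fun x => if x ∈ B then 0 else φ x + 1, ⟨?_, ?_⟩, ?_⟩
    · intro x
      have := hv.1 x
      simp only
      split_ifs <;> omega
    · intro i hi
      cases i with
      | zero => rw [hb0]; exact ⟨hne, hdv⟩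
      | succ i => rw [hbs i (by omega)]; exact hv.2 i (by omega)
    · intro x hx
      have h1 : x ∉ B := fun h => hx (hB h)
      simp only [h1, if_false]
      rw [hφ x (by simp [hx])]

theorem exists_valid (d : ℕ) (h : ∀ s, d * K.m ≤ K.w s univ) : ∃ φ, K.Valid d φ := by
  obtain ⟨φ, h1, _⟩ := K.exists_valid_aux d univ h
  exact ⟨φ, h1⟩

theorem exists_opt {d : ℕ} {φ : ι → ℕ} (h : K.Valid d φ) : ∃ ψ, K.Opt d ψ ∧ K.cost ψ ≤ K.cost φ := by
  classical
  have hex : ∃ c, ∃ ψ, K.Valid d ψ ∧ K.cost ψ = c := ⟨_, φ, h, rfl⟩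
  obtain ⟨ψ, h1, h2⟩ := Nat.find_spec hex
  refine ⟨ψ, ⟨h1, fun χ hχ => ?_⟩, ?_⟩
  · rw [h2]; exact Nat.find_min' hex ⟨χ, hχ, rfl⟩
  · rw [h2]; exact Nat.find_min' hex ⟨φ, h, rfl⟩

theorem mono_step {d : ℕ} {φ : ι → ℕ} (h : K.Valid (d + 1) φ) :
    ∃ ψ, K.Valid d ψ ∧ K.cost ψ ≤ K.cost φ ∧ (1 ≤ d → K.cost ψ < K.cost φ) := by
  have hle : ∀ x, (φ x - 1) * K.p ^ K.lev x ≤ φ x * K.p ^ K.lev x := fun x =>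
    Nat.mul_le_mul_right _ (Nat.sub_le _ _)
  refine ⟨fun x => φ x - 1, ⟨?_, ?_⟩, ?_, ?_⟩
  · intro x
    have := h.1 x
    simp only
    omega
  · intro i hi
    cases i with
    | zero =>
      have e : bx (fun x => φ x - 1) 0 = bx φ 0 ∪ bx φ 1 := by
        ext x; simp only [mem_bx, mem_union]; omega
      have hdis : Disjoint (bx φ 0) (bx φ 1) := by
        rw [disjoint_left]
        intro x hx hx2
        rw [mem_bx] at hx hx2
        omega
      rw [e, K.v_union hdis]
      have h0 := h.2 0 (by omega)
      have h1 := h.2 1 (by omega)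
      exact ⟨h0.1.mono subset_union_left, dvd_add h0.2 h1.2⟩
    | succ i =>
      have e : bx (fun x => φ x - 1) (i + 1) = bx φ (i + 2) := by
        ext x; simp only [mem_bx]; omega
      rw [e]
      exact h.2 (i + 2) (by omega)
  · exact sum_le_sum fun x _ => hle x
  · intro hd
    obtain ⟨y, hy⟩ := (h.2 1 (by omega)).1
    rw [mem_bx] at hy
    refine sum_lt_sum (fun x _ => hle x) ⟨y, mem_univ _, ?_⟩
    simp [hy, K.p_pos]

theorem mono {d d' : ℕ} (hdd : d < d') {φ : ι → ℕ} (h : K.Valid d' φ) :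
    ∃ ψ, K.Valid d ψ ∧ K.cost ψ ≤ K.cost φ ∧ (1 ≤ d → K.cost ψ < K.cost φ) := by
  obtain ⟨n, rfl⟩ : ∃ n, d' = d + n + 1 := ⟨d' - d - 1, by omega⟩
  clear hdd
  induction n generalizing φ with
  | zero => exact K.mono_step h
  | succ n ih =>
    obtain ⟨ψ, h1, h2, _⟩ := K.mono_step h
    obtain ⟨χ, g1, g2, g3⟩ := ih h1
    exact ⟨χ, g1, g2.trans h2, fun hd => (g3 hd).trans_le h2⟩

end Ctx
end MZ

set_option linter.unusedSectionVars false
set_option linter.unusedVariables false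
namespace MZ
open Finset
variable {ι : Type} [Fintype ι] [DecidableEq ι]

theorem field_sum (Fq : Type) [Field Fq] [Fintype Fq] (e : ℕ) :
    ∑ y : Fq, y ^ e = if 0 < e ∧ Fintype.card Fq - 1 ∣ e then -1 else 0 := by
  classical
  rcases Nat.eq_zero_or_pos e with h | h
  · subst h
    simp
  · have h1 := FiniteField.sum_pow_units Fq e
    have h2 : ∑ y : Fq, y ^ e = ∑ y : Fqˣ, (y : Fq) ^ e := by
      rw [← sum_erase univ (f := fun y : Fq => y ^ e) (a := 0) (zero_pow h.ne')]
      symm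
      refine sum_bij (fun y _ => (y : Fq)) ?_ ?_ ?_ ?_
      · intro y _; simp
      · intro a _ b _ hab; exact Units.ext hab
      · intro y hy
        have hy0 : y ≠ 0 := by simpa using hy
        exact ⟨Units.mk0 y hy0, mem_univ _, rfl⟩
      · intro y _; rfl
    rw [h2, h1]
    simp [h]

namespace Ctx
variable (K : Ctx ι) (Fq : Type) [Field Fq] [Fintype Fq]

theorem expand (hcard : Fintype.card Fq = K.p ^ K.f) (d : ℕ) (c : ℕ → Fq) :
    (∑ i ∈ range (d + 1), C (c i) * X ^ i : Fq[X]) ^ (K.v univ) =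
      ∑ φ ∈ Fintype.piFinset (fun _ : ι => range (d + 1)),
        C (∏ i ∈ range (d + 1), c i ^ K.v (bx φ i)) * X ^ K.cost φ := by
  have : Fact K.p.Prime := ⟨K.hp⟩
  have : CharP Fq K.p := charP_of_card_eq_prime_pow hcard
  have : ExpChar Fq[X] K.p := ExpChar.prime K.hp
  unfold v
  rw [← prod_pow_eq_pow_sum]
  simp_rw [sum_pow_char_pow]
  rw [prod_univ_sum]
  refine sum_congr rfl fun φ hφ => ?_
  simp_rw [mul_pow, prod_mul_distrib]
  congr 1
  · rw [map_prod, ← prod_fiberwise_of_maps_to (s := univ) (t := range (d + 1)) (g := φ)]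
    · refine prod_congr rfl fun i _ => ?_
      rw [← prod_pow_eq_pow_sum, map_prod]
      refine prod_congr rfl fun x hx => ?_
      rw [(mem_filter.mp hx).2, C_pow]
    · intro x _
      exact (Fintype.mem_piFinset.mp hφ) x
  · unfold cost
    rw [← prod_pow_eq_pow_sum]
    refine prod_congr rfl fun x _ => ?_
    rw [← pow_mul]

open Classical in
theorem powerSum_eq (hcard : Fintype.card Fq = K.p ^ K.f) (d : ℕ) :
    powerSum Fq d (K.v univ) = C ((-1) ^ d) *
      ∑ φ ∈ (Fintype.piFinset (fun _ : ι => range (d + 1))).filter (fun φ => K.Valid d φ),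
        X ^ K.cost φ := by
  unfold powerSum
  have h1 : ∀ c : Fin d → Fq, (X ^ d + ∑ i : Fin d, C (c i) * X ^ (i : ℕ) : Fq[X]) ^ (K.v univ) =
      ∑ φ ∈ Fintype.piFinset (fun _ : ι => range (d + 1)),
        C (∏ i : Fin d, c i ^ K.v (bx φ i)) * X ^ K.cost φ := by
    intro c
    have := K.expand Fq hcard d (fun i => if h : i < d then c ⟨i, h⟩ else 1)
    rw [sum_range_succ, sum_range] at this
    simp only [Fin.is_lt, dite_true, lt_irrefl, dite_false, C_1, one_mul, Fin.eta] at this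
    rw [add_comm, this]
    refine sum_congr rfl fun φ _ => ?_
    rw [prod_range_succ, prod_range]
    simp
  simp_rw [h1]
  rw [sum_comm, mul_sum, sum_filter]
  refine sum_congr rfl fun φ hφ => ?_
  rw [← sum_mul, ← map_sum]
  have h2 : ∑ c : Fin d → Fq, ∏ i : Fin d, c i ^ K.v (bx φ i) = if K.Valid d φ then (-1) ^ d else 0 := by
    have := prod_univ_sum (fun _ : Fin d => (univ : Finset Fq)) (fun i y => y ^ K.v (bx φ i))
    rw [Fintype.piFinset_univ] at this
    rw [← this]
    simp_rw [field_sum]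
    have hle : ∀ x, φ x ≤ d := fun x => by
      have := Fintype.mem_piFinset.mp hφ x
      rw [mem_range] at this
      omega
    have hcm : Fintype.card Fq - 1 = K.m := by rw [hcard, K.hm]; rfl
    have hpos : ∀ i, 0 < K.v (bx φ i) ↔ (bx φ i).Nonempty := by
      intro i
      constructor
      · intro h
        by_contra h2
        rw [not_nonempty_iff_eq_empty] at h2
        simp [v, h2] at h
      · intro h
        exact sum_pos (fun _ _ => pow_pos K.p_pos _) h
    rw [hcm]
    simp_rw [hpos]
    split_ifs with hv
    · rw [prod_congr rfl (fun i _ => if_pos (hv.2 _ (Fin.is_lt _)))]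
      simp
    · have : ∃ i : Fin d, ¬ ((bx φ i).Nonempty ∧ K.m ∣ K.v (bx φ i)) := by
        by_contra hcon
        push Not at hcon
        exact hv ⟨hle, fun i hi => hcon ⟨i, hi⟩⟩
      obtain ⟨i, hi⟩ := this
      exact prod_eq_zero (mem_univ i) (if_neg hi)
  rw [h2]
  split_ifs <;> simp

theorem powerSum_opt (hcard : Fintype.card Fq = K.p ^ K.f) (d : ℕ) {φ : ι → ℕ} (hO : K.Opt d φ) :
    powerSum Fq d (K.v univ) ≠ 0 ∧ (powerSum Fq d (K.v univ)).natTrailingDegree = K.cost φ := by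
  classical
  have : Fact K.p.Prime := ⟨K.hp⟩
  have : CharP Fq K.p := charP_of_card_eq_prime_pow hcard
  have hco : ∀ n, (powerSum Fq d (K.v univ)).coeff n = (-1) ^ d *
      ((((Fintype.piFinset (fun _ : ι => range (d + 1))).filter 
        (fun φ => K.Valid d φ)).filter (fun φ => n = K.cost φ)).card : Fq) := by
    intro n
    rw [K.powerSum_eq Fq hcard, coeff_C_mul, finsetSum_coeff]
    simp_rw [coeff_X_pow]
    rw [sum_boole]
  have h1 : (powerSum Fq d (K.v univ)).coeff (K.cost φ) ≠ 0 := by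
    rw [hco]
    refine mul_ne_zero (pow_ne_zero _ (neg_ne_zero.mpr one_ne_zero)) ?_
    rw [Ne, CharP.cast_eq_zero_iff Fq K.p]
    apply opt_card K d φ hO
    intro ψ
    simp only [mem_filter, Fintype.mem_piFinset, mem_range]
    constructor
    · rintro ⟨⟨_, h2⟩, h3⟩
      exact ⟨h2, fun χ hχ => by rw [← h3]; exact hO.2 χ hχ⟩
    · intro h
      exact ⟨⟨fun x => by have := h.1.1 x; omega, h.1⟩, le_antisymm (hO.2 _ h.1) (h.2 _ hO.1)⟩
  have hne : powerSum Fq d (K.v univ) ≠ 0 := by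
    intro h
    rw [h] at h1
    simp at h1
  refine ⟨hne, le_antisymm (natTrailingDegree_le_of_ne_zero h1) (le_natTrailingDegree hne ?_)⟩
  intro n hn
  rw [hco, filter_eq_empty_iff.mpr]
  · simp
  · intro ψ hψ h
    have := hO.2 ψ (mem_filter.mp hψ).2
    omega

theorem powerSum_valid (hcard : Fintype.card Fq = K.p ^ K.f) (d : ℕ)
    (h : powerSum Fq d (K.v univ) ≠ 0) : ∃ φ, K.Opt d φ := by
  classical
  by_contra hcon
  push Not at hcon
  apply h
  rw [K.powerSum_eq Fq hcard, filter_eq_empty_iff.mpr]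
  · simp
  · intro φ _ hv
    obtain ⟨ψ, hψ, _⟩ := K.exists_opt hv
    exact hcon ψ hψ

theorem valid_d_le {d : ℕ} {φ : ι → ℕ} (h : K.Valid d φ) : d ≤ K.v univ := by
  have h1 : ∀ i ∈ range d, ∃ x, φ x = i := by
    intro i hi
    obtain ⟨x, hx⟩ := (h.2 i (mem_range.mp hi)).1
    exact ⟨x, (mem_bx _ _ _).mp hx⟩
  have h2 : range d ⊆ univ.image φ := by
    intro i hi
    obtain ⟨x, hx⟩ := h1 i hi
    exact mem_image.mpr ⟨x, mem_univ _, hx⟩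
  have h3 := (card_le_card h2).trans card_image_le
  rw [card_range, card_eq_sum_ones] at h3
  refine h3.trans (sum_le_sum fun x _ => ?_)
  exact Nat.pow_pos K.p_pos

end Ctx

/-- The balls of the base `p` expansion of `k`. -/
def kctx (p f m k : ℕ) (hp : p.Prime) (hf : 0 < f) (hm : p ^ f = m + 1) :
    Ctx (Σ j : Fin (k + 1), Fin (k / p ^ (j : ℕ) % p)) where
  p := p
  f := f
  m := m
  lev := fun x => (x.1 : ℕ)
  hp := hp
  hf := hf
  hm := hm
  hlev := by
    intro L
    by_cases hL : L < k + 1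
    · have h1 : univ.filter (fun x : (Σ j : Fin (k + 1), Fin (k / p ^ (j : ℕ) % p)) => (x.1 : ℕ) = L) ⊆
          univ.image (fun y : Fin (k / p ^ L % p) => (⟨⟨L, hL⟩, y⟩ : (Σ j : Fin (k + 1), Fin (k / p ^ (j : ℕ) % p)))) := by
        rintro ⟨⟨j, hj⟩, y⟩ hx
        have : j = L := by simpa using hx
        subst this
        exact mem_image.mpr ⟨y, mem_univ _, rfl⟩
      have h2 := (card_le_card h1).trans card_image_le
      rw [card_univ, Fintype.card_fin] at h2
      exact lt_of_le_of_lt h2 (Nat.mod_lt _ hp.pos)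
    · rw [filter_eq_empty_iff.mpr]
      · simpa using hp.pos
      · rintro ⟨⟨j, hj⟩, y⟩ _
        simp only
        omega

theorem kctx_v (p f m k : ℕ) (hp : p.Prime) (hf : 0 < f) (hm : p ^ f = m + 1) :
    (kctx p f m k hp hf hm).v univ = k := by
  have h : ∀ n, ∑ j ∈ range n, k / p ^ j % p * p ^ j = k % p ^ n := by
    intro n
    induction n with
    | zero => simp [Nat.mod_one]
    | succ n ih => rw [sum_range_succ, ih, Nat.mod_pow_succ, mul_comm]
  have h2 := h (k + 1)
  have h3 : k < p ^ (k + 1) := (Nat.lt_pow_self hp.one_lt).trans (Nat.pow_lt_pow_right hp.one_lt (by omega))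
  rw [Nat.mod_eq_of_lt h3, sum_range] at h2
  unfold Ctx.v kctx
  simp only
  rw [Fintype.sum_sigma]
  simp only [sum_const, card_univ, Fintype.card_fin, smul_eq_mul]
  exact h2

end MZ

set_option linter.unusedSectionVars false
set_option linter.unusedVariables false
namespace MZ
open Finset

/-- base `q` digit sum -/
def ds (q n : ℕ) : ℕ := (Nat.digits q n).sum

theorem ds_rec (q : ℕ) (hq : 1 < q) (n : ℕ) : ds q n = n % q + ds q (n / q) := by
  unfold ds
  rcases Nat.eq_zero_or_pos n with h | h
  · subst h; simp
  · rw [Nat.digits_def' hq h, List.sum_cons]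

theorem ds_succ (q : ℕ) (hq : 1 < q) (n : ℕ) : ds q (n + 1) ≤ ds q n + 1 := by
  induction n using Nat.strong_induction_on with
  | _ n ih =>
    rw [ds_rec q hq (n + 1), ds_rec q hq n]
    have hq0 : 0 < q := by omega
    by_cases h : n % q + 1 < q
    · have h1 : (n + 1) % q = n % q + 1 := by
        rw [Nat.add_mod, Nat.mod_eq_of_lt hq, Nat.mod_eq_of_lt h]
      have h2 : (n + 1) / q = n / q := by
        rw [Nat.add_div hq0, Nat.div_eq_of_lt hq, Nat.mod_eq_of_lt hq, if_neg (by omega), add_zero, add_zero]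
      rw [h1, h2]; omega
    · have h3 := Nat.mod_lt n hq0
      have h4 : n % q + 1 = q := by omega
      have h1 : (n + 1) % q = 0 := by
        rw [Nat.add_mod, Nat.mod_eq_of_lt hq, h4, Nat.mod_self]
      have h2 : (n + 1) / q = n / q + 1 := by
        rw [Nat.add_div hq0, Nat.div_eq_of_lt hq, Nat.mod_eq_of_lt hq, if_pos (by omega)]
      rw [h1, h2]
      have hn : 0 < n := by
        rcases Nat.eq_zero_or_pos n with h | h
        · subst h; simp at h4; omega
        · exact h
      have := ih (n / q) (Nat.div_lt_self hn hq)
      omega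

theorem ds_add (q : ℕ) (hq : 1 < q) (a : ℕ) : ∀ b, ds q (a + b) ≤ ds q a + ds q b := by
  induction a using Nat.strong_induction_on with
  | _ a ih =>
    intro b
    have hq0 : 0 < q := by omega
    rcases Nat.eq_zero_or_pos a with h | h
    · subst h; simp
    have h1 := ih (a / q) (Nat.div_lt_self h hq) (b / q)
    rw [ds_rec q hq (a + b), ds_rec q hq a, ds_rec q hq b, Nat.add_div hq0]
    have h3 := Nat.mod_lt a hq0
    have h4 := Nat.mod_lt b hq0
    split_ifs with h2
    · have h5 := ds_succ q hq (a / q + b / q)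
      have h6 := Nat.add_mod_add_of_le_add_mod h2
      omega
    · have h6 : (a + b) % q = a % q + b % q := Nat.add_mod_of_add_mod_lt (by omega)
      rw [h6, add_zero]
      omega

theorem ds_le (q : ℕ) (hq : 1 < q) (n : ℕ) : ds q n ≤ n := by
  induction n with
  | zero => simp [ds]
  | succ n ih => exact (ds_succ q hq n).trans (by omega)

theorem ds_pow_mul (q : ℕ) (hq : 1 < q) (a c : ℕ) : ds q (q ^ a * c) ≤ c := by
  induction a with
  | zero => simpa using ds_le q hq c
  | succ a ih =>
    have h1 : q ^ (a + 1) * c = q * (q ^ a * c) := by ring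
    rw [ds_rec q hq, h1, Nat.mul_mod_right, Nat.mul_div_cancel_left _ (by omega), zero_add]
    exact ih

theorem ds_sum {ι : Type} (q : ℕ) (hq : 1 < q) (A : Finset ι) (a c : ι → ℕ) :
    ds q (∑ x ∈ A, q ^ a x * c x) ≤ ∑ x ∈ A, c x := by
  classical
  induction A using Finset.induction_on with
  | empty => simp [ds]
  | insert x A hx ih =>
    rw [sum_insert hx, sum_insert hx]
    exact (ds_add q hq _ _).trans (Nat.add_le_add (ds_pow_mul q hq _ _) ih)

theorem Ctx.ds_w {ι : Type} [Fintype ι] [DecidableEq ι] (K : Ctx ι) (s : ℕ) :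
    ds (K.p ^ K.f) (K.v univ * K.p ^ s) ≤ K.w s univ := by
  have h1 : K.v univ * K.p ^ s =
      ∑ x : ι, (K.p ^ K.f) ^ ((K.lev x + s) / K.f) * K.p ^ ((K.lev x + s) % K.f) := by
    unfold Ctx.v
    rw [sum_mul]
    refine sum_congr rfl fun x _ => ?_
    rw [← pow_mul, ← pow_add, ← pow_add, Nat.div_add_mod]
  rw [h1]
  exact ds_sum _ (Nat.one_lt_pow K.hf.ne' K.one_lt_p) _ _ _

theorem lval (p f m k : ℕ) (hp : p.Prime) (hf : 0 < f) (hm : p ^ f = m + 1) (d : ℕ)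
    (h : (d : ℚ) ≤ Lval p f k hf) (s : ℕ) : d * m ≤ (kctx p f m k hp hf hm).w s univ := by
  set K := kctx p f m k hp hf hm with hK
  rw [K.w_modf]
  have hs : s % f < f := Nat.mod_lt _ hf
  have h1 := h.trans (Finset.inf'_le _ (mem_range.mpr hs))
  have h2 : (p : ℚ) ^ f - 1 = m := by
    have : ((p ^ f : ℕ) : ℚ) = ((m + 1 : ℕ) : ℚ) := by rw [hm]
    push_cast at this
    linarith
  have hm0 : (0 : ℚ) < m := by exact_mod_cast K.m_pos
  rw [h2, le_div_iff₀ hm0] at h1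
  have h3 : d * m ≤ ds (p ^ f) (k * p ^ (s % f)) := by
    unfold ds
    exact_mod_cast h1
  have h4 := K.ds_w (s % f)
  rw [kctx_v] at h4
  exact h3.trans h4

/-- Facts about single power sums used in the final argument. -/
theorem ps_all (p f k : ℕ) (hp : p.Prime) (hf : 0 < f) (Fq : Type) [Field Fq] [Fintype Fq]
    (hcard : Fintype.card Fq = p ^ f) :
    (∀ d : ℕ, d = 0 ∨ (d : ℚ) ≤ Lval p f k hf → powerSum Fq d k ≠ 0) ∧
    (∀ d : ℕ, powerSum Fq d k ≠ 0 → d ≤ k) ∧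
    (∀ d d' : ℕ, d < d' → powerSum Fq d k ≠ 0 → powerSum Fq d' k ≠ 0 →
      (powerSum Fq d k).natTrailingDegree ≤ (powerSum Fq d' k).natTrailingDegree ∧
      (1 ≤ d → (powerSum Fq d k).natTrailingDegree < (powerSum Fq d' k).natTrailingDegree)) := by
  obtain ⟨m, hm⟩ : ∃ m, p ^ f = m + 1 := ⟨p ^ f - 1, by have := Nat.pow_pos (n := f) hp.pos; omega⟩
  have hv := kctx_v p f m k hp hf hm
  set K := kctx p f m k hp hf hm with hK
  have hc : Fintype.card Fq = K.p ^ K.f := hcard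
  have ho := K.powerSum_opt Fq hc
  have hva := K.powerSum_valid Fq hc
  rw [hv] at ho hva
  refine ⟨?_, ?_, ?_⟩
  · intro d hd
    have : ∃ φ, K.Valid d φ := by
      apply K.exists_valid
      intro s
      rcases hd with rfl | hd
      · simp
      · exact lval p f m k hp hf hm d hd s
    obtain ⟨φ, hφ⟩ := this
    obtain ⟨ψ, hψ, _⟩ := K.exists_opt hφ
    exact (ho d hψ).1
  · intro d h
    obtain ⟨φ, hφ⟩ := hva d h
    have := K.valid_d_le hφ.1
    rwa [hv] at this
  · intro d d' hdd h h'
    obtain ⟨φ, hφ⟩ := hva d h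
    obtain ⟨φ', hφ'⟩ := hva d' h'
    obtain ⟨ψ, h1, h2, h3⟩ := K.mono hdd hφ'.1
    rw [(ho d hφ).2, (ho d' hφ').2]
    have h4 := hφ.2 ψ h1
    exact ⟨h4.trans h2, fun hd => lt_of_le_of_lt h4 (h3 hd)⟩

theorem ntd_prod {Fq : Type} [Field Fq] {α : Type} (s : Finset α) (g : α → Fq[X])
    (h : ∀ i ∈ s, g i ≠ 0) :
    (∏ i ∈ s, g i).natTrailingDegree = ∑ i ∈ s, (g i).natTrailingDegree := by
  classical
  induction s using Finset.induction_on with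
  | empty => simp
  | insert x s hx ih =>
    rw [prod_insert hx, sum_insert hx, natTrailingDegree_mul (h x (mem_insert_self _ _))
      (prod_ne_zero_iff.mpr fun i hi => h i (mem_insert_of_mem hi)),
      ih fun i hi => h i (mem_insert_of_mem hi)]

/-- One dominating term determines the valuation of a sum. -/
theorem ntd_sum {Fq : Type} [Field Fq] {α : Type} (s : Finset α) (g : α → Fq[X]) (a : α)
    (ha : a ∈ s) (h0 : g a ≠ 0)
    (h : ∀ b ∈ s, b ≠ a → g b ≠ 0 → (g a).natTrailingDegree < (g b).natTrailingDegree) :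
    ∑ b ∈ s, g b ≠ 0 ∧ (∑ b ∈ s, g b).natTrailingDegree = (g a).natTrailingDegree := by
  classical
  have hz : ∀ n ≤ (g a).natTrailingDegree, (∑ b ∈ s, g b).coeff n = (g a).coeff n := by
    intro n hn
    rw [finsetSum_coeff]
    refine sum_eq_single_of_mem a ha fun b hb hba => ?_
    by_cases hb0 : g b = 0
    · simp [hb0]
    · exact coeff_eq_zero_of_lt_natTrailingDegree (lt_of_le_of_lt hn (h b hb hba hb0))
  have h1 : (∑ b ∈ s, g b).coeff (g a).natTrailingDegree ≠ 0 := by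
    rw [hz _ le_rfl]
    exact mt trailingCoeff_eq_zero.mp h0
  have hne : ∑ b ∈ s, g b ≠ 0 := by
    intro h
    rw [h] at h1
    simp at h1
  refine ⟨hne, le_antisymm (natTrailingDegree_le_of_ne_zero h1) (le_natTrailingDegree hne ?_)⟩
  intro n hn
  rw [hz n hn.le]
  exact coeff_eq_zero_of_lt_natTrailingDegree hn

theorem anti_ge {r : ℕ} (dt : Fin r → ℕ) (h : StrictAnti dt) :
    ∀ (n : ℕ) (i : Fin r), r - 1 - (i : ℕ) = n → n ≤ dt i := by
  intro n
  induction n with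
  | zero => intro i _; omega
  | succ n ih =>
    intro i hi
    have hlt : (i : ℕ) + 1 < r := by omega
    have h1 := ih ⟨(i : ℕ) + 1, hlt⟩ (by simp only; omega)
    have h2 : dt ⟨(i : ℕ) + 1, hlt⟩ < dt i := h (by rw [Fin.lt_def]; simp)
    omega

end MZ

/-- if `r - i ≤ L_{-s_i}` for all `1 ≤ i ≤ r-1` (0-indexed: `i+1 < r`), then
the `t`-adic valuation of `ζ(s)` is `∑ i, v_t(S_{r-i}(s_i))`; in particular `ζ(s) ≠ 0`. -/
theorem multizeta_valuation_nontrivial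
    (p f : ℕ) (hp : p.Prime) (hf : 0 < f)
    (Fq : Type) [Field Fq] [Fintype Fq] (hcard : Fintype.card Fq = p ^ f)
    (r : ℕ) (hr : 1 < r) (k : Fin r → ℕ) (hk : ∀ i, 0 < k i)
    (hnt : ∀ i : Fin r, (i : ℕ) + 1 < r → (r : ℚ) - (i : ℚ) - 1 ≤ Lval p f (k i) hf) :
    multizeta Fq k ≠ 0 ∧
      (multizeta Fq k).natTrailingDegree =
        ∑ i : Fin r, (powerSum Fq (r - 1 - (i : ℕ)) (k i)).natTrailingDegree := by
  classical
  have hps := fun i => MZ.ps_all p f (k i) hp hf Fq hcard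
  have hne : ∀ i : Fin r, powerSum Fq (r - 1 - (i : ℕ)) (k i) ≠ 0 := by
    intro i
    apply (hps i).1
    by_cases hi : (i : ℕ) + 1 < r
    · right
      have h1 : ((r - 1 - (i : ℕ) : ℕ) : ℚ) = (r : ℚ) - (i : ℚ) - 1 := by
        rw [Nat.cast_sub (by omega), Nat.cast_sub (by omega)]
        push_cast
        ring
      rw [h1]
      exact hnt i hi
    · left
      omega
  let d0 : Fin r → ℕ := fun i => r - 1 - (i : ℕ)
  have hd0 : StrictAnti d0 := by
    intro i j hij
    have := j.isLt
    have hij' : (i : ℕ) < (j : ℕ) := hij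
    change r - 1 - (j : ℕ) < r - 1 - (i : ℕ)
    omega
  let g : (Fin r → ℕ) → Fq[X] := fun dt => ∏ i, powerSum Fq (dt i) (k i)
  let B : Finset (Fin r → ℕ) :=
    (Fintype.piFinset fun i => Finset.range (k i + 1)).filter fun dt => StrictAnti dt
  have hg0 : g d0 ≠ 0 := Finset.prod_ne_zero_iff.mpr fun i _ => hne i
  have hfac : ∀ dt, g dt ≠ 0 → ∀ i, powerSum Fq (dt i) (k i) ≠ 0 := fun dt h i =>
    Finset.prod_ne_zero_iff.mp h i (Finset.mem_univ i)
  have hB : ∀ dt, StrictAnti dt → g dt ≠ 0 → dt ∈ B := by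
    intro dt hdt h
    refine Finset.mem_filter.mpr ⟨Fintype.mem_piFinset.mpr fun i => Finset.mem_range.mpr ?_, hdt⟩
    have := (hps i).2.1 _ (hfac dt h i)
    omega
  have hmz : multizeta Fq k = ∑ dt ∈ B, g dt := by
    unfold multizeta
    rw [finsum_eq_sum_of_support_subset (s := B)]
    · refine Finset.sum_congr rfl fun dt hdt => ?_
      rw [finsum_eq_if, if_pos (Finset.mem_filter.mp hdt).2]
    · intro dt hdt
      rw [Function.mem_support, finsum_eq_if] at hdt
      split_ifs at hdt with h
      · exact hB dt h hdt
      · exact absurd rfl hdt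
  have hmain := MZ.ntd_sum B g d0 (hB d0 hd0 hg0) hg0 ?_
  · rw [hmz]
    refine ⟨hmain.1, hmain.2.trans ?_⟩
    exact MZ.ntd_prod Finset.univ _ fun i _ => hne i
  · intro dt hdtB hdt0 hgdt
    have hdt : StrictAnti dt := (Finset.mem_filter.mp hdtB).2
    have hge : ∀ i : Fin r, r - 1 - (i : ℕ) ≤ dt i := fun i => MZ.anti_ge dt hdt _ i rfl
    have hf1 := hfac dt hgdt
    have e1 : (g d0).natTrailingDegree = _ := MZ.ntd_prod Finset.univ _ fun i _ => hne i
    have e2 : (g dt).natTrailingDegree = _ := MZ.ntd_prod Finset.univ _ fun i _ => hf1 i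
    rw [e1, e2]
    apply Finset.sum_lt_sum
    · intro i _
      rcases (hge i).lt_or_eq with h | h
      · exact ((hps i).2.2 _ _ h (hne i) (hf1 i)).1
      · rw [← h]
    · have hex : ∃ i : Fin r, (i : ℕ) + 1 < r ∧ r - 1 - (i : ℕ) < dt i := by
        by_contra hcon
        push Not at hcon
        apply hdt0
        funext i
        change dt i = r - 1 - (i : ℕ)
        by_cases hi : (i : ℕ) + 1 < r
        · exact le_antisymm (hcon i hi) (hge i)
        · have h1 := hcon ⟨r - 2, by omega⟩ (by simp only; omega)
          have h2 : dt i < dt ⟨r - 2, by omega⟩ := hdt (by rw [Fin.lt_def]; simp only; omega)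
          simp only at h1
          omega
      obtain ⟨i, hi, hlt⟩ := hex
      exact ⟨i, Finset.mem_univ _, ((hps i).2.2 _ _ hlt (hne i) (hf1 i)).2 (by omega)⟩
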